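/- arXiv:2308.02301 — 2 statements merged into one kernel-verified Lean document; each statement's English description precedes it below -/
import Mathlib

section
/- Suppose S is finite, and each entry Q_{x̄,ȳ}:[0,T]×Σ×U→ℝ of the Kolmogorov matrix is continuous, bounded, and Lipschitz continuous in μ uniformly with respect to (t,u), where Σ is the probability simplex on S. Then for every 0≤s<r≤T, every μ*∈Σ and every feedback control ζ_S=(ζ_x̄)_{x̄∈S} with ζ_x̄∈U_{s,r}, the nonlinear Kolmogorov equation dμ_ȳ(t)/dt = Σ_x̄ μ_x̄(t)𝒬_{x̄,ȳ}(t,μ(t),ζ_S), μ(s)=μ*, has a unique absolutely continuous solution μ(·) on [s,r], and μ(t)∈Σ (i.e., μ_x̄(t)≥0 for all x̄ and Σ_x̄ μ_x̄(t)=1) for every t∈[s,r]. -/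
open MeasureTheory Set
open scoped ENNReal NNReal

noncomputable section

/-- Euclidean space `ℝ^d`. -/
abbrev Euc (d : ℕ) := EuclideanSpace ℝ (Fin d)

/-- Probability measures on `ℝ^d` with finite second moment (`P²(ℝ^d)`). -/
def MemP2 {d : ℕ} (m : Measure (Euc d)) : Prop :=
  IsProbabilityMeasure m ∧ ∫⁻ x, (‖x‖₊ : ℝ≥0∞) ^ 2 ∂m < ⊤

/-- The measure `m` is supported in the (closed) set `K`. -/
def SuppIn {d : ℕ} (K : Set (Euc d)) (m : Measure (Euc d)) : Prop := m Kᶜ = 0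

/-- `P²(K)`: probability measures with finite second moment supported in `K`. -/
def MemP2K {d : ℕ} (K : Set (Euc d)) (m : Measure (Euc d)) : Prop := MemP2 m ∧ SuppIn K m

/-- Couplings (transport plans) between two measures on `ℝ^d`. -/
def Couplings {d : ℕ} (m₁ m₂ : Measure (Euc d)) : Set (Measure (Euc d × Euc d)) :=
  {π | IsProbabilityMeasure π ∧ π.map Prod.fst = m₁ ∧ π.map Prod.snd = m₂}

/-- Squared 2-Wasserstein distance. -/
def W2sq {d : ℕ} (m₁ m₂ : Measure (Euc d)) : ℝ :=
  sInf ((fun π : Measure (Euc d × Euc d) => ∫ p, ‖p.1 - p.2‖ ^ 2 ∂π) '' Couplings m₁ m₂)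

/-- 2-Wasserstein distance `W₂`. -/
def W2 {d : ℕ} (m₁ m₂ : Measure (Euc d)) : ℝ := Real.sqrt (W2sq m₁ m₂)

/-- An optimal plan between `m₁` and `m₂`. -/
def IsOptimalPlan {d : ℕ} (m₁ m₂ : Measure (Euc d)) (π : Measure (Euc d × Euc d)) : Prop :=
  π ∈ Couplings m₁ m₂ ∧ ∫ p, ‖p.1 - p.2‖ ^ 2 ∂π = W2sq m₁ m₂

/-- Standing assumptions (C1)–(C5) on the dynamics `f`. -/
structure DynHyp {d : ℕ} {U : Type} [TopologicalSpace U] (T R Cf : ℝ) (K : Set (Euc d))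
    (f : ℝ → Euc d → Measure (Euc d) → U → Euc d) : Prop where
  cont : ∀ m, Continuous fun p : ℝ × Euc d × U => f p.1 p.2.1 m p.2.2
  zero_outside : ∀ t x m u, SuppIn K m → x ∉ K → f t x m u = 0
  bounded : ∀ t x m u, t ∈ Icc 0 T → x ∈ K → MemP2K K m → ‖f t x m u‖ ≤ R
  lipschitz : ∀ t x x' m m' u, t ∈ Icc 0 T → x ∈ K → x' ∈ K → MemP2K K m → MemP2K K m' →
    ‖f t x m u - f t x' m' u‖ ≤ Cf * (‖x - x'‖ + W2 m m')

/-- Relaxed controls `U_{s,r}`: measures on `[s,r] × U` whose time marginal is Lebesgue. -/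
def RelaxedControls {U : Type} [MeasurableSpace U] (s r : ℝ) : Set (Measure (ℝ × U)) :=
  {ξ | ξ.map Prod.fst = volume.restrict (Icc s r)}

/-- `x(·) = x(·,s,y,m(·),ξ)` solves `ẋ(t) = ∫_U f(t,x(t),m(t),u) ξ(du|t)`, `x(s)=y`,
written in the equivalent integral form against the relaxed control `ξ`. -/
def IsTraj {d : ℕ} {U : Type} [MeasurableSpace U]
    (f : ℝ → Euc d → Measure (Euc d) → U → Euc d) (s r : ℝ)
    (m : ℝ → Measure (Euc d)) (ξ : Measure (ℝ × U)) (y : Euc d) (x : ℝ → Euc d) : Prop :=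
  Continuous x ∧ x s = y ∧ ∀ t ∈ Icc s r,
    x t = y + ∫ p in (Icc s t ×ˢ (univ : Set U)), f p.1 (x p.1) (m p.1) p.2 ∂ξ

/-- `A_{s,r}[m]`: distributions of pairs (initial state, relaxed control) with first marginal `m`. -/
def ControlDistrs {d : ℕ} (U : Type) [MeasurableSpace U] (s r : ℝ) (m : Measure (Euc d)) :
    Set (Measure (Euc d × Measure (ℝ × U))) :=
  {α | IsProbabilityMeasure α ∧ α.map Prod.fst = m ∧ ∀ᵐ p ∂α, p.2 ∈ RelaxedControls (U := U) s r}

/-- `m(·) = m(·,s,α)` is the motion of the mean field type control system produced by the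
initial time `s` and the distribution of controls `α`. -/
def IsMotion {d : ℕ} {U : Type} [MeasurableSpace U]
    (f : ℝ → Euc d → Measure (Euc d) → U → Euc d) (s r : ℝ) (mstar : Measure (Euc d))
    (α : Measure (Euc d × Measure (ℝ × U))) (m : ℝ → Measure (Euc d)) : Prop :=
  m s = mstar ∧ ∃ traj : Euc d × Measure (ℝ × U) → ℝ → Euc d,
    (∀ᵐ p ∂α, IsTraj f s r m p.2 p.1 (traj p)) ∧
    ∀ t ∈ Icc s r, m t = α.map fun p => traj p t

/-- Concatenation `ξ₀ ⋄_{s₁} ξ₁` of relaxed controls. -/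
def concatControl {U : Type} [MeasurableSpace U] (s₁ : ℝ) (ξ₀ ξ₁ : Measure (ℝ × U)) :
    Measure (ℝ × U) :=
  ξ₀.restrict ((Iio s₁) ×ˢ (univ : Set U)) + ξ₁.restrict ((Ici s₁) ×ˢ (univ : Set U))

/-- `α` is the concatenation `α₀ ⋄_{s₁} α₁` of distributions of controls: there are a motion of
`α₀` with trajectories `traj`, and a disintegration `β` of `α₁` w.r.t. its first marginal `m₁`,
such that `α` is obtained by concatenating controls along the trajectories. -/
def IsConcatDistr {d : ℕ} {U : Type} [MeasurableSpace U]
    (f : ℝ → Euc d → Measure (Euc d) → U → Euc d) (s₀ s₁ : ℝ) (m₀ m₁ : Measure (Euc d))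
    (α₀ α₁ α : Measure (Euc d × Measure (ℝ × U))) : Prop :=
  ∃ (mflow : ℝ → Measure (Euc d)) (traj : Euc d × Measure (ℝ × U) → ℝ → Euc d)
    (β : Euc d → Measure (Measure (ℝ × U))),
    IsMotion f s₀ s₁ m₀ α₀ mflow ∧
    (∀ᵐ p ∂α₀, IsTraj f s₀ s₁ mflow p.2 p.1 (traj p)) ∧
    α₁ = m₁.bind (fun y => (β y).map fun ξ => (y, ξ)) ∧
    α = α₀.bind fun p => (β (traj p s₁)).map fun ξ₁ => (p.1, concatControl s₁ p.2 ξ₁)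

/-- A (relaxed) feedback control at a single state: a weakly measurable family of probabilities
on `U`, i.e. the disintegration `ζ(du|t)` of an element of `U_{s,r}`. -/
def IsFeedback {U : Type} [MeasurableSpace U] [TopologicalSpace U] (ζ : ℝ → Measure U) : Prop :=
  (∀ t, IsProbabilityMeasure (ζ t)) ∧ ∀ g : C(U, ℝ), Measurable fun t => ∫ u, g u ∂(ζ t)

/-- Trajectory driven by a feedback (kernel-form) relaxed control `ζ(du|t)`. -/
def IsTrajKer {d : ℕ} {U : Type} [MeasurableSpace U]
    (f : ℝ → Euc d → Measure (Euc d) → U → Euc d) (s r : ℝ)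
    (m : ℝ → Measure (Euc d)) (ζ : ℝ → Measure U) (y : Euc d) (x : ℝ → Euc d) : Prop :=
  Continuous x ∧ x s = y ∧ ∀ t ∈ Icc s r,
    x t = y + ∫ t' in Icc s t, ∫ u, f t' (x t') (m t') u ∂(ζ t')

/-! ### Mean field Markov chains -/

/-- `Σ²`: summable nonnegative weights with total mass one and finite second moment. -/
def InSigma2 {d : ℕ} (S : Set (Euc d)) (μ : S → ℝ) : Prop :=
  (∀ x, 0 ≤ μ x) ∧ HasSum μ 1 ∧ Summable fun x : S => ‖(x : Euc d)‖ ^ 2 * μ x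

/-- The embedding `I : Σ² → P²(ℝ^d)`, `I(μ) = Σ_x̄ μ_x̄ δ_x̄`. -/
def Imeas {d : ℕ} (S : Set (Euc d)) (μ : S → ℝ) : Measure (Euc d) :=
  Measure.sum fun x : S => (Real.toNNReal (μ x)) • Measure.dirac (x : Euc d)

/-- `Q` is a Kolmogorov matrix (on the relevant domain). -/
def IsKolmogorov {d : ℕ} {U : Type} (S : Set (Euc d)) (T : ℝ)
    (Q : ℝ → (S → ℝ) → U → S → S → ℝ) : Prop :=
  ∀ t ∈ Icc 0 T, ∀ μ : S → ℝ, InSigma2 S μ → ∀ (u : U) (x : S),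
    (∀ y, x ≠ y → 0 ≤ Q t μ u x y) ∧ HasSum (Q t μ u x) 0

/-- The relaxed transition rate `𝒬_{x̄,ȳ}(t,μ,ζ_S) = ∫_U Q_{x̄,ȳ}(t,μ,u) ζ_x̄(du|t)`. -/
def Qbar {d : ℕ} {U : Type} [MeasurableSpace U] (S : Set (Euc d))
    (Q : ℝ → (S → ℝ) → U → S → S → ℝ) (ζ : S → ℝ → Measure U)
    (t : ℝ) (μ : S → ℝ) (x y : S) : ℝ :=
  ∫ u, Q t μ u x y ∂(ζ x t)

/-- Motion of the mean field Markov chain: the (integral form of the) nonlinear Kolmogorov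
equation `dμ_ȳ(t)/dt = Σ_x̄ μ_x̄(t) 𝒬_{x̄,ȳ}(t,μ(t),ζ_S)`, `μ(s) = μ*`. -/
def IsChainMotion {d : ℕ} {U : Type} [MeasurableSpace U] (S : Set (Euc d))
    (Q : ℝ → (S → ℝ) → U → S → S → ℝ) (s r : ℝ) (μstar : S → ℝ)
    (ζ : S → ℝ → Measure U) (μ : ℝ → S → ℝ) : Prop :=
  μ s = μstar ∧ ∀ t ∈ Icc s r, ∀ y : S,
    μ t y = μstar y + ∫ t' in Icc s t, ∑' x : S, μ t' x * Qbar S Q ζ t' (μ t') x y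

/-- (A1): `S` is an `ε`-net of `K`. -/
def CondA1 {d : ℕ} (S K : Set (Euc d)) (ε : ℝ) : Prop :=
  ∀ x ∈ K, ∃ y ∈ S, ‖x - y‖ ≤ ε

/-- (A2): the entries of `Q` are bounded by `B`. -/
def CondA2 {d : ℕ} {U : Type} (S : Set (Euc d)) (T : ℝ)
    (Q : ℝ → (S → ℝ) → U → S → S → ℝ) (B : ℝ) : Prop :=
  ∀ t ∈ Icc 0 T, ∀ μ : S → ℝ, InSigma2 S μ → ∀ (u : U) (x y : S), |Q t μ u x y| ≤ B

/-- (A3): the expected drift of the chain approximates `f` up to `ε`. -/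
def CondA3 {d : ℕ} {U : Type} (S : Set (Euc d)) (T : ℝ)
    (f : ℝ → Euc d → Measure (Euc d) → U → Euc d)
    (Q : ℝ → (S → ℝ) → U → S → S → ℝ) (ε : ℝ) : Prop :=
  ∀ t ∈ Icc 0 T, ∀ μ : S → ℝ, InSigma2 S μ → ∀ (u : U) (x : S),
    ‖f t (x : Euc d) (Imeas S μ) u - ∑' y : S, Q t μ u x y • ((y : Euc d) - (x : Euc d))‖ ≤ ε

/-- (A4): the quadratic variation rate of the chain is at most `ε²`. -/
def CondA4 {d : ℕ} {U : Type} (S : Set (Euc d)) (T : ℝ)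
    (Q : ℝ → (S → ℝ) → U → S → S → ℝ) (ε : ℝ) : Prop :=
  ∀ t ∈ Icc 0 T, ∀ μ : S → ℝ, InSigma2 S μ → ∀ (u : U) (x : S),
    ∑' y : S, Q t μ u x y * ‖(y : Euc d) - (x : Euc d)‖ ^ 2 ≤ ε ^ 2

/-- The generator `L_t[μ,ζ_S]φ` of the mean field Markov chain, extended by `0` off `S`. -/
def chainGen {d : ℕ} {U : Type} [MeasurableSpace U] (S : Set (Euc d))
    (Q : ℝ → (S → ℝ) → U → S → S → ℝ) (ζ : S → ℝ → Measure U) (μflow : ℝ → S → ℝ)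
    (φ : Euc d → ℝ) (t : ℝ) (z : Euc d) : ℝ :=
  open scoped Classical in
  if h : z ∈ S then ∑' y : S, Qbar S Q ζ t (μflow t) ⟨z, h⟩ y * φ (y : Euc d) else 0

/-- A realization of the flow `μ(·)` of the mean field Markov chain on `[s,r]`: a filtered
probability space with an adapted `S`-valued process `X` whose one-dimensional laws are `μ(·)`
and such that `φ(X(t)) - ∫_s^t L_{t'}[μ(t'),ζ_S]φ(X(t')) dt'` is a martingale for every
bounded `φ`. -/
def IsRealization {d : ℕ} {U : Type} [MeasurableSpace U] (S : Set (Euc d))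
    (Q : ℝ → (S → ℝ) → U → S → S → ℝ) (s r : ℝ) (ζ : S → ℝ → Measure U) (μ : ℝ → S → ℝ)
    {Ω : Type} [inst : MeasurableSpace Ω] (ℱ : ℝ → MeasurableSpace Ω) (P : Measure Ω)
    (X : ℝ → Ω → Euc d) : Prop :=
  IsProbabilityMeasure P ∧
  (∀ t, ℱ t ≤ inst) ∧ Monotone ℱ ∧
  (∀ t ∈ Icc s r, ∀ ω, X t ω ∈ S) ∧
  (∀ t ∈ Icc s r, Measurable[ℱ t] (X t)) ∧
  (∀ t ∈ Icc s r, ∀ x : S, μ t x = (P {ω | X t ω = (x : Euc d)}).toReal) ∧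
  ∀ φ : Euc d → ℝ, (∃ C, ∀ z, |φ z| ≤ C) →
    (∀ t ∈ Icc s r,
      Integrable (fun ω => φ (X t ω) - ∫ t' in Icc s t, chainGen S Q ζ μ φ t' (X t' ω)) P) ∧
    (∀ t₁ ∈ Icc s r, ∀ t₂ ∈ Icc s r, t₁ ≤ t₂ → ∀ A, MeasurableSet[ℱ t₁] A →
      ∫ ω in A, (φ (X t₂ ω) - ∫ t' in Icc s t₂, chainGen S Q ζ μ φ t' (X t' ω)) ∂P
        = ∫ ω in A, (φ (X t₁ ω) - ∫ t' in Icc s t₁, chainGen S Q ζ μ φ t' (X t' ω)) ∂P)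

/-- The model predictive flow (rules (D1)–(D2)) for the deterministic system, built from the
feedback strategy `ζ` of the chain and its motion `μ(·)` along the partition `σ`. -/
def IsMPCFlow {d : ℕ} {U : Type} [MeasurableSpace U]
    (f : ℝ → Euc d → Measure (Euc d) → U → Euc d) (S : Set (Euc d))
    (ζ : S → ℝ → Measure U) (μ : ℝ → S → ℝ) (n : ℕ) (σ : Fin (n + 1) → ℝ)
    (m₀ : Measure (Euc d)) (m : ℝ → Measure (Euc d)) : Prop :=
  m (σ 0) = m₀ ∧ ∀ k : Fin n,
    ∃ π : Measure (Euc d × Euc d),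
      IsOptimalPlan (m (σ k.castSucc)) (Imeas S (μ (σ k.castSucc))) π ∧
      ∃ x : Euc d × Euc d → ℝ → Euc d,
        (∀ᵐ p ∂π, ∃ h : p.2 ∈ S,
          IsTrajKer f (σ k.castSucc) (σ k.succ) m (ζ ⟨p.2, h⟩) p.1 (x p)) ∧
        ∀ t ∈ Icc (σ k.castSucc) (σ k.succ), m t = π.map fun p => x p t

/-- The probability simplex on `S`. -/
def InSimplex {d : ℕ} (S : Set (Euc d)) (μ : S → ℝ) : Prop :=
  (∀ x, 0 ≤ μ x) ∧ HasSum μ 1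

section

open Filter Topology

theorem IsFeedback.measurable {U : Type} [MetricSpace U] [MeasurableSpace U] [BorelSpace U]
    {ζ : ℝ → Measure U} (hζ : IsFeedback ζ) : Measurable ζ := by
  have := hζ.1
  refine Measurable.measure_of_isPiSystem_of_isProbabilityMeasure
    ((BorelSpace.measurable_eq (α := U)).trans borel_eq_generateFrom_isClosed)
    isPiSystem_isClosed fun F hF => ?_
  obtain ⟨δ, -, hδ, hlim⟩ := exists_seq_strictAnti_tendsto (0 : ℝ)
  have hreal : Measurable fun t => (ζ t).real F := by
    refine measurable_of_tendsto_metrizable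
      (f := fun n t => ∫ u, (thickenedIndicator (hδ n) F u : ℝ) ∂(ζ t)) (fun n => ?_)
      (tendsto_pi_nhds.2 fun t => tendsto_integral_thickenedIndicator_of_isClosed _ hF hδ hlim)
    exact hζ.2 ⟨fun u => (thickenedIndicator (hδ n) F u : ℝ), by fun_prop⟩
  simpa [Measure.real] using hreal.ennreal_ofReal

/-- Integral form of Grönwall's inequality for nonnegative continuous functions. -/
theorem le_mul_exp_of_le_add_mul_integral {φ : ℝ → ℝ} {a b m K : ℝ} (hK : 0 ≤ K)
    (hφ : ContinuousOn φ (Icc a b)) (hφ0 : ∀ t ∈ Icc a b, 0 ≤ φ t)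
    (h : ∀ t ∈ Icc a b, φ t ≤ m + K * ∫ τ in a..t, φ τ) :
    ∀ t ∈ Icc a b, φ t ≤ m * Real.exp (K * (t - a)) := by
  intro t ht
  have hab : a ≤ b := ht.1.trans ht.2
  set φ' : ℝ → ℝ := fun t => φ (max a (min b t)) with hφ'
  have hc : Continuous φ' := hφ.comp_continuous (by fun_prop) fun t =>
    ⟨le_max_left _ _, max_le hab (min_le_left _ _)⟩
  have heq : ∀ t ∈ Icc a b, φ' t = φ t := fun t ht => by
    simp [hφ', min_eq_right ht.2, max_eq_right ht.1]
  have hint : ∀ t ∈ Icc a b, ∫ τ in a..t, φ' τ = ∫ τ in a..t, φ τ := fun t ht => by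
    refine intervalIntegral.integral_congr fun τ hτ => heq τ ?_
    rw [uIcc_of_le ht.1] at hτ
    exact ⟨hτ.1, hτ.2.trans ht.2⟩
  set ψ : ℝ → ℝ := fun t => m + K * ∫ τ in a..t, φ' τ with hψ
  have hd : ∀ t, HasDerivAt ψ (K * φ' t) t := fun t =>
    ((hc.integral_hasStrictDerivAt a t).hasDerivAt.const_mul K).const_add m
  have hle : ∀ t ∈ Icc a b, φ t ≤ ψ t := fun t ht => by
    simpa only [hψ, hint t ht] using h t ht
  have hψ0 : ∀ t ∈ Icc a b, 0 ≤ ψ t := fun t ht => (hφ0 t ht).trans (hle t ht)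
  have hψa : ψ a = m := by simp [hψ]
  have key := norm_le_gronwallBound_of_norm_deriv_right_le (f := ψ) (f' := fun t => K * φ' t)
    (δ := m) (K := K) (ε := 0) (a := a) (b := b)
    (fun t _ => (hd t).continuousAt.continuousWithinAt) (fun t _ => (hd t).hasDerivWithinAt)
    (by rw [Real.norm_of_nonneg (hψ0 a (left_mem_Icc.2 hab)), hψa])
    (fun t ht => by
      have ht' := Ico_subset_Icc_self ht
      rw [heq t ht', Real.norm_of_nonneg (hψ0 t ht'),
        Real.norm_of_nonneg (mul_nonneg hK (hφ0 t ht')), add_zero]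
      exact mul_le_mul_of_nonneg_left (hle t ht') hK) t ht
  rw [gronwallBound_ε0, Real.norm_of_nonneg (hψ0 t ht)] at key
  exact (hle t ht).trans key

/-- A time-dependent vector field on `ι → ℝ` of Carathéodory type with linear growth which is
Lipschitz continuous around the standard simplex. -/
structure IsSimplexField {ι : Type*} [Fintype ι] (K : ℝ) (F : ℝ → (ι → ℝ) → ι → ℝ) : Prop where
  nonneg : 0 ≤ K
  measurable : ∀ μ : ℝ → ι → ℝ, Measurable μ → ∀ y, Measurable fun t => F t (μ t) y
  growth : ∀ t v, ‖F t v‖ ≤ K * ‖v‖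
  lipschitz : ∀ t v, ∀ w ∈ stdSimplex ℝ ι, ‖F t v - F t w‖ ≤ K * ‖v - w‖

/-- `μ` solves the integral equation `μ t = m + ∫_s^t F(τ, μ(τ)) dτ` on `[s, r]`. -/
def IsIntegralSolution {ι : Type*} (F : ℝ → (ι → ℝ) → ι → ℝ) (s r : ℝ) (m : ι → ℝ)
    (μ : ℝ → ι → ℝ) : Prop :=
  ∀ t ∈ Icc s r, ∀ y, μ t y = m y + ∫ τ in s..t, F τ (μ τ) y

theorem IsIntegralSolution.continuousOn_apply {ι : Type*} {F : ℝ → (ι → ℝ) → ι → ℝ} {s r : ℝ}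
    {m : ι → ℝ} {μ : ℝ → ι → ℝ} (hμ : IsIntegralSolution F s r m μ) {t : ℝ}
    (ht : t ∈ Icc s r) {y : ι} (hy : IntegrableOn (fun τ => F τ (μ τ) y) (Ioc s t)) :
    ContinuousOn (fun τ => μ τ y) (Icc s t) := by
  have h := intervalIntegral.continuousOn_primitive_interval (a := s) (b := t) (μ := volume)
    (f := fun τ => F τ (μ τ) y) (by rwa [uIcc_of_le ht.1, integrableOn_Icc_iff_integrableOn_Ioc])
  rw [uIcc_of_le ht.1] at h
  exact (continuousOn_const.add h).congr fun τ hτ => hμ τ ⟨hτ.1, hτ.2.trans ht.2⟩ y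

section

variable {ι : Type*} [Fintype ι] {K : ℝ} {F : ℝ → (ι → ℝ) → ι → ℝ} {s r : ℝ} {m : ι → ℝ}
  {μ ν : ℝ → ι → ℝ}

theorem IsSimplexField.integrableOn (hF : IsSimplexField K F) {A : Set ℝ} (hA : MeasurableSet A)
    (hAfin : volume A ≠ ⊤) (hμ : AEMeasurable μ (volume.restrict A)) {M : ℝ}
    (hM : ∀ t ∈ A, ‖μ t‖ ≤ M) (y : ι) : IntegrableOn (fun t => F t (μ t) y) A := by
  have : IsFiniteMeasure (volume.restrict A) := ⟨by simpa using hAfin.lt_top⟩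
  refine Integrable.of_bound (C := K * M)
    ((hF.measurable _ hμ.measurable_mk y).aestronglyMeasurable.congr
      (hμ.ae_eq_mk.mono fun t ht => ?_)) ?_
  · simp only [ht]
  · filter_upwards [ae_restrict_mem hA] with t ht
    exact (norm_le_pi_norm _ y).trans
      ((hF.growth _ _).trans (mul_le_mul_of_nonneg_left (hM t ht) hF.nonneg))

theorem IsIntegralSolution.norm_le (hF : IsSimplexField K F) (hμ : IsIntegralSolution F s r m μ)
    {t : ℝ} (ht : t ∈ Icc s r) (hint : ∀ y, IntegrableOn (fun τ => F τ (μ τ) y) (Ioc s t)) :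
    ‖μ t‖ ≤ ‖m‖ * Real.exp (K * (t - s)) := by
  have hc : ContinuousOn μ (Icc s t) :=
    continuousOn_pi.2 fun y => hμ.continuousOn_apply ht (hint y)
  refine le_mul_exp_of_le_add_mul_integral (φ := fun τ => ‖μ τ‖) hF.nonneg hc.norm
    (fun _ _ => norm_nonneg _) (fun τ hτ => ?_) t (right_mem_Icc.2 ht.1)
  have hi : IntervalIntegrable (fun τ => ‖μ τ‖) volume s τ :=
    (hc.norm.mono (Icc_subset_Icc_right hτ.2)).intervalIntegrable_of_Icc hτ.1
  have hnn : 0 ≤ ∫ τ in s..τ, ‖μ τ‖ :=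
    intervalIntegral.integral_nonneg hτ.1 fun _ _ => norm_nonneg _
  refine (pi_norm_le_iff_of_nonneg (by have := hF.nonneg; positivity)).2 fun y => ?_
  rw [hμ τ ⟨hτ.1, hτ.2.trans ht.2⟩ y]
  refine (norm_add_le _ _).trans (add_le_add (norm_le_pi_norm _ y) ?_)
  rw [← intervalIntegral.integral_const_mul]
  exact intervalIntegral.norm_integral_le_of_norm_le hτ.1
    (ae_of_all _ fun σ _ => (norm_le_pi_norm _ y).trans (hF.growth _ _)) (hi.const_mul K)

theorem IsIntegralSolution.exists_integrableOn_right (hF : IsSimplexField K F)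
    (hμ : IsIntegralSolution F s r m μ) {t : ℝ} (ht : t ∈ Ico s r)
    (hint : ∀ y, IntegrableOn (fun τ => F τ (μ τ) y) (Ioc s t)) :
    ∃ t₁ ∈ Ioc t r, ∀ y, IntegrableOn (fun τ => F τ (μ τ) y) (Ioc s t₁) := by
  have hev : ∀ y, ∀ᶠ t' in 𝓝[>] t, IntegrableOn (fun τ => F τ (μ τ) y) (Ioc s t') ∨
      ∀ τ ∈ Ioc t r, ¬ IntegrableOn (fun τ => F τ (μ τ) y) (Ioc s τ) := fun y => by
    by_cases h : ∃ τ ∈ Ioc t r, IntegrableOn (fun τ => F τ (μ τ) y) (Ioc s τ)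
    · obtain ⟨τ, hτ, hi⟩ := h
      filter_upwards [Ioc_mem_nhdsGT hτ.1] with t' ht'
      exact Or.inl (hi.mono_set (Ioc_subset_Ioc_right ht'.2))
    · push Not at h
      exact Eventually.of_forall fun _ => Or.inr h
  obtain ⟨t₁, h₁, ht₁⟩ := ((eventually_all.2 hev).and (Ioc_mem_nhdsGT ht.2)).exists
  have ht₁' : t₁ ∈ Icc s r := ⟨ht.1.trans ht₁.1.le, ht₁.2⟩
  have hcomp : ∀ y, AEMeasurable (fun τ => μ τ y) (volume.restrict (Ioc s t₁)) ∧
      ∃ M, ∀ τ ∈ Ioc s t₁, ‖μ τ y‖ ≤ M := fun y => by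
    rcases h₁ y with hi | hi
    · have hc := hμ.continuousOn_apply ht₁' hi
      obtain ⟨M, hM⟩ := isCompact_Icc.exists_bound_of_continuousOn hc
      exact ⟨(hc.mono Ioc_subset_Icc_self).aemeasurable measurableSet_Ioc,
        M, fun τ hτ => hM τ (Ioc_subset_Icc_self hτ)⟩
    · have hc := hμ.continuousOn_apply (Ico_subset_Icc_self ht) (hint y)
      have hconst : ∀ τ ∈ Ioc t t₁, μ τ y = m y := fun τ hτ => by
        have hτ' : τ ∈ Ioc t r := ⟨hτ.1, hτ.2.trans ht₁.2⟩
        have hsτ : s ≤ τ := ht.1.trans hτ.1.le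
        rw [hμ τ ⟨hsτ, hτ'.2⟩ y, intervalIntegral.integral_undef, add_zero]
        rw [intervalIntegrable_iff_integrableOn_Ioc_of_le hsτ]
        exact hi τ hτ'
      obtain ⟨M, hM⟩ := isCompact_Icc.exists_bound_of_continuousOn hc
      rw [← Ioc_union_Ioc_eq_Ioc ht.1 ht₁.1.le]
      refine ⟨aemeasurable_union_iff.2
        ⟨(hc.mono Ioc_subset_Icc_self).aemeasurable measurableSet_Ioc, ?_⟩, max M ‖m y‖, ?_⟩
      · refine (aemeasurable_const (b := m y)).congr ?_
        filter_upwards [ae_restrict_mem measurableSet_Ioc] with τ hτ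
        exact (hconst τ hτ).symm
      · rintro τ (hτ | hτ)
        · exact (hM τ (Ioc_subset_Icc_self hτ)).trans (le_max_left _ _)
        · exact (hconst τ hτ ▸ le_max_right _ _)
  choose hmeas M hM using hcomp
  refine ⟨t₁, ht₁, hF.integrableOn measurableSet_Ioc (by simp) (aemeasurable_pi_iff.2 hmeas)
    (M := ∑ y, |M y|) fun τ hτ => ?_⟩
  refine (pi_norm_le_iff_of_nonneg (by positivity)).2 fun y => ?_
  exact ((hM y τ hτ).trans (le_abs_self _)).trans
    (Finset.single_le_sum (f := fun y => |M y|) (fun _ _ => abs_nonneg _) (Finset.mem_univ y))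

/-- Along any solution the field is integrable, although this is not part of the definition. -/
theorem IsIntegralSolution.integrableOn (hF : IsSimplexField K F)
    (hμ : IsIntegralSolution F s r m μ) (hsr : s ≤ r) (y : ι) :
    IntegrableOn (fun τ => F τ (μ τ) y) (Ioc s r) := by
  suffices h : Icc s r ⊆ {t | ∀ y, IntegrableOn (fun τ => F τ (μ τ) y) (Ioc s t)} from
    h (right_mem_Icc.2 hsr) y
  refine IsClosed.Icc_subset_of_forall_mem_nhdsWithin ?_ (by simp) ?_
  · refine IsSeqClosed.isClosed fun x t hx hxt => ?_
    have ht : t ∈ Icc s r := isClosed_Icc.mem_of_tendsto hxt (Eventually.of_forall fun n => (hx n).2)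
    refine ⟨fun y => ?_, ht⟩
    set B := K * (‖m‖ * Real.exp (K * (r - s)))
    have hB0 : 0 ≤ B := by have := hF.nonneg; positivity
    refine integrableOn_Ioc_of_intervalIntegral_norm_bounded_right (l := atTop) (b := x)
      (I := B * (r - s)) (fun n => (hx n).1 y) hxt (Eventually.of_forall fun n => ?_)
    have hle : ∀ τ ∈ Ioc s (x n), ‖‖F τ (μ τ) y‖‖ ≤ B := fun τ hτ => by
      rw [norm_norm]
      refine (norm_le_pi_norm _ y).trans ((hF.growth _ _).trans
        (mul_le_mul_of_nonneg_left ?_ hF.nonneg))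
      have hτr : τ ≤ r := hτ.2.trans (hx n).2.2
      refine (hμ.norm_le hF ⟨hτ.1.le, hτr⟩ fun y =>
        ((hx n).1 y).mono_set (Ioc_subset_Ioc_right hτ.2)).trans ?_
      have := hF.nonneg
      gcongr
    refine (le_abs_self _).trans ((norm_setIntegral_le_of_norm_le_const (by simp) hle).trans ?_)
    rw [Real.volume_real_Ioc_of_le (hx n).2.1]
    exact mul_le_mul_of_nonneg_left (by linarith [(hx n).2.2]) hB0
  · rintro t ⟨hint, ht⟩
    obtain ⟨t₁, ht₁, h₁⟩ := hμ.exists_integrableOn_right hF ht hint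
    exact mem_of_superset (Ioc_mem_nhdsGT ht₁.1) fun τ hτ y =>
      (h₁ y).mono_set (Ioc_subset_Ioc_right hτ.2)

theorem IsIntegralSolution.eqOn (hF : IsSimplexField K F) (hμ : IsIntegralSolution F s r m μ)
    (hν : IsIntegralSolution F s r m ν) (hν' : ∀ t ∈ Icc s r, ν t ∈ stdSimplex ℝ ι) :
    EqOn μ ν (Icc s r) := by
  intro t ht
  have hsr : s ≤ r := ht.1.trans ht.2
  have hr := right_mem_Icc.2 hsr
  have hc : ContinuousOn (fun τ => μ τ - ν τ) (Icc s r) :=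
    (continuousOn_pi.2 fun y => hμ.continuousOn_apply hr (hμ.integrableOn hF hsr y)).sub
      (continuousOn_pi.2 fun y => hν.continuousOn_apply hr (hν.integrableOn hF hsr y))
  have key := le_mul_exp_of_le_add_mul_integral (φ := fun τ => ‖μ τ - ν τ‖) (m := 0) hF.nonneg
    hc.norm (fun _ _ => norm_nonneg _) (fun τ hτ => ?_) t ht
  · rw [zero_mul] at key
    exact sub_eq_zero.1 (norm_le_zero_iff.1 key)
  have hi : IntervalIntegrable (fun τ => ‖μ τ - ν τ‖) volume s τ :=
    (hc.norm.mono (Icc_subset_Icc_right hτ.2)).intervalIntegrable_of_Icc hτ.1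
  have hnn : 0 ≤ ∫ τ in s..τ, ‖μ τ - ν τ‖ :=
    intervalIntegral.integral_nonneg hτ.1 fun _ _ => norm_nonneg _
  refine (pi_norm_le_iff_of_nonneg (by have := hF.nonneg; positivity)).2 fun y => ?_
  have hii : ∀ {η : ℝ → ι → ℝ}, IsIntegralSolution F s r m η →
      IntervalIntegrable (fun τ => F τ (η τ) y) volume s τ := fun hη =>
    (intervalIntegrable_iff_integrableOn_Ioc_of_le hτ.1).2
      ((hη.integrableOn hF hsr y).mono_set (Ioc_subset_Ioc_right hτ.2))
  rw [Pi.sub_apply, hμ τ hτ y, hν τ hτ y, add_sub_add_left_eq_sub,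
    ← intervalIntegral.integral_sub (hii hμ) (hii hν), zero_add,
    ← intervalIntegral.integral_const_mul]
  refine intervalIntegral.norm_integral_le_of_norm_le hτ.1
    (ae_of_all _ fun σ hσ => ?_) (hi.const_mul K)
  exact (norm_le_pi_norm (F σ (μ σ) - F σ (ν σ)) y).trans
    (hF.lipschitz _ _ _ (hν' σ ⟨hσ.1.le, hσ.2.trans hτ.2⟩))

end

/-- Variation of constants: `u b = c + ∫_s^b (h - K u)` for
`u t = e^{-K(t-s)} (c + ∫_s^t e^{K(τ-s)} h τ dτ)`. -/
theorem exp_neg_mul_add_integral_eq {K c s b : ℝ} {h u : ℝ → ℝ} (hsb : s ≤ b)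
    (hh : IntervalIntegrable h volume s b)
    (hu : ∀ t ∈ Icc s b, u t =
      Real.exp (-K * (t - s)) * (c + ∫ τ in s..t, Real.exp (K * (τ - s)) * h τ)) :
    u b = c + ∫ τ in s..b, (h τ - K * u τ) := by
  set E : ℝ → ℝ := fun t => Real.exp (-K * (t - s)) with hE
  set H : ℝ → ℝ := fun t => c + ∫ τ in s..t, Real.exp (K * (τ - s)) * h τ with hH
  have hEd : ∀ t, HasDerivAt E (-K * E t) t := fun t => by
    have := (((hasDerivAt_id t).sub_const s).const_mul (-K)).exp
    simpa [hE, mul_comm] using this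
  have hint : IntervalIntegrable (fun τ => Real.exp (K * (τ - s)) * h τ) volume s b :=
    hh.continuousOn_mul (by fun_prop)
  have hEac : AbsolutelyContinuousOnInterval E s b := by
    have hcont : Continuous fun t => -K * E t := by fun_prop
    have hEeq : E = fun t => 1 + ∫ τ in s..t, -K * E τ := by
      funext t
      rw [intervalIntegral.integral_eq_sub_of_hasDerivAt (fun τ _ => hEd τ)
        (hcont.intervalIntegrable _ _)]
      simp [hE]
    rw [hEeq]
    exact (LipschitzWith.const (1 : ℝ)).lipschitzOnWith.absolutelyContinuousOnInterval.fun_add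
      ((hcont.intervalIntegrable _ _).absolutelyContinuousOnInterval_intervalIntegral
        left_mem_uIcc)
  have hHac : AbsolutelyContinuousOnInterval H s b :=
    (LipschitzWith.const c).lipschitzOnWith.absolutelyContinuousOnInterval.fun_add
      (hint.absolutelyContinuousOnInterval_intervalIntegral left_mem_uIcc)
  have key := hEac.integral_deriv_mul_eq_sub hHac
  have hcongr : ∫ τ in s..b, (h τ - K * u τ) = ∫ τ in s..b, deriv E τ * H τ + E τ * deriv H τ := by
    refine intervalIntegral.integral_congr_ae ?_
    filter_upwards [hint.ae_hasDerivAt_integral] with τ hτ hτm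
    have hτm' := uIoc_subset_uIcc hτm
    have hHd : HasDerivAt H (Real.exp (K * (τ - s)) * h τ) τ :=
      (hτ hτm' s left_mem_uIcc).const_add c
    have huH : u τ = E τ * H τ := hu τ (by rwa [uIcc_of_le hsb] at hτm')
    have hEE : E τ * Real.exp (K * (τ - s)) = 1 := by simp [hE, ← Real.exp_add]
    rw [(hEd τ).deriv, hHd.deriv, huH]
    linear_combination (-h τ) * hEE
  rw [hcongr, key, hu b (right_mem_Icc.2 hsb)]
  simp [hE, hH]

/-- The Picard operator of the equation `μ' = F(t, μ)` rewritten as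
`μ' + K μ = K μ + F(t, μ)`. In this form it preserves the standard simplex. -/
def expPicard {ι : Type*} (K : ℝ) (F : ℝ → (ι → ℝ) → ι → ℝ) (s : ℝ) (m : ι → ℝ)
    (μ : ℝ → ι → ℝ) (t : ℝ) (y : ι) : ℝ :=
  Real.exp (-K * (t - s)) *
    (m y + ∫ τ in s..t, Real.exp (K * (τ - s)) * (K * μ τ y + F τ (μ τ) y))

section

variable {ι : Type*} [Fintype ι] {K : ℝ} {F : ℝ → (ι → ℝ) → ι → ℝ} {s r : ℝ} {m : ι → ℝ}
  {μ ν : ℝ → ι → ℝ}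

theorem norm_le_one_of_mem_stdSimplex {v : ι → ℝ} (hv : v ∈ stdSimplex ℝ ι) : ‖v‖ ≤ 1 := by
  refine (pi_norm_le_iff_of_nonneg zero_le_one).2 fun y => ?_
  have := mem_Icc_of_mem_stdSimplex hv y
  rw [Real.norm_of_nonneg this.1]
  exact this.2

theorem IsSimplexField.intervalIntegrable (hF : IsSimplexField K F) (hμ : Continuous μ) (a b : ℝ)
    (y : ι) : IntervalIntegrable (fun τ => F τ (μ τ) y) volume a b := by
  obtain ⟨M, hM⟩ := isCompact_uIcc.exists_bound_of_continuousOn (s := uIcc a b) hμ.continuousOn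
  rw [intervalIntegrable_iff]
  exact hF.integrableOn measurableSet_uIoc (by simp [uIoc]) hμ.measurable.aemeasurable
    (fun t ht => hM t (uIoc_subset_uIcc ht)) y

theorem IsSimplexField.intervalIntegrable_exp_mul (hF : IsSimplexField K F) (hμ : Continuous μ)
    (a b : ℝ) (y : ι) : IntervalIntegrable
      (fun τ => Real.exp (K * (τ - s)) * (K * μ τ y + F τ (μ τ) y)) volume a b := by
  refine IntervalIntegrable.continuousOn_mul (.add ?_ (hF.intervalIntegrable hμ a b y))
    (by fun_prop)
  exact (by fun_prop : Continuous fun τ => K * μ τ y).intervalIntegrable _ _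

theorem IsSimplexField.continuous_expPicard (hF : IsSimplexField K F) (hμ : Continuous μ) :
    Continuous (expPicard K F s m μ) := by
  refine continuous_pi fun y => ?_
  have := intervalIntegral.continuous_primitive (μ := volume)
    (fun a b => hF.intervalIntegrable_exp_mul (s := s) hμ a b y) s
  unfold expPicard
  fun_prop

theorem IsSimplexField.expPicard_mem_stdSimplex (hF : IsSimplexField K F)
    (hpos : ∀ t ∈ Icc s r, ∀ w ∈ stdSimplex ℝ ι, ∀ y, 0 ≤ K * w y + F t w y)
    (hsum : ∀ t ∈ Icc s r, ∀ w ∈ stdSimplex ℝ ι, ∑ y, F t w y = 0)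
    (hm : m ∈ stdSimplex ℝ ι) (hμ : Continuous μ) (hμs : ∀ t ∈ Icc s r, μ t ∈ stdSimplex ℝ ι)
    {t : ℝ} (ht : t ∈ Icc s r) : expPicard K F s m μ t ∈ stdSimplex ℝ ι := by
  constructor
  · refine fun y => mul_nonneg (Real.exp_nonneg _) (add_nonneg (hm.1 y) ?_)
    refine intervalIntegral.integral_nonneg ht.1 fun τ hτ => ?_
    have hτ' : τ ∈ Icc s r := ⟨hτ.1, hτ.2.trans ht.2⟩
    exact mul_nonneg (Real.exp_nonneg _) (hpos τ hτ' _ (hμs τ hτ') y)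
  · have hd : ∀ τ, HasDerivAt (fun τ => Real.exp (K * (τ - s))) (Real.exp (K * (τ - s)) * K) τ :=
      fun τ => by
        have := (((hasDerivAt_id τ).sub_const s).const_mul K).exp
        simpa using this
    have hI : ∫ τ in s..t, ∑ y, Real.exp (K * (τ - s)) * (K * μ τ y + F τ (μ τ) y) =
        Real.exp (K * (t - s)) - 1 := by
      rw [intervalIntegral.integral_congr (g := fun τ => Real.exp (K * (τ - s)) * K),
        intervalIntegral.integral_eq_sub_of_hasDerivAt (fun τ _ => hd τ)
          ((by fun_prop : Continuous _).intervalIntegrable _ _)]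
      · simp
      · intro τ hτ
        rw [uIcc_of_le ht.1] at hτ
        have hτ' : τ ∈ Icc s r := ⟨hτ.1, hτ.2.trans ht.2⟩
        simp only
        rw [← Finset.mul_sum, Finset.sum_add_distrib, ← Finset.mul_sum, (hμs τ hτ').2,
          hsum τ hτ' _ (hμs τ hτ')]
        ring
    unfold expPicard
    rw [← Finset.mul_sum, Finset.sum_add_distrib, hm.2, ← intervalIntegral.integral_finsetSum
      (fun y _ => hF.intervalIntegrable_exp_mul hμ s t y), hI, add_sub_cancel, ← Real.exp_add]
    simp

theorem IsSimplexField.norm_expPicard_sub_le (hF : IsSimplexField K F) (hμ : Continuous μ)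
    (hν : Continuous ν) (hνs : ∀ t ∈ Icc s r, ν t ∈ stdSimplex ℝ ι) {B : ℝ → ℝ}
    (hB : Continuous B) (hle : ∀ t ∈ Icc s r, ‖μ t - ν t‖ ≤ B t) {t : ℝ} (ht : t ∈ Icc s r) :
    ‖expPicard K F s m μ t - expPicard K F s m ν t‖ ≤ 2 * K * ∫ τ in s..t, B τ := by
  have hK := hF.nonneg
  have hB0 : 0 ≤ ∫ τ in s..t, B τ := intervalIntegral.integral_nonneg ht.1 fun τ hτ =>
    (norm_nonneg _).trans (hle τ ⟨hτ.1, hτ.2.trans ht.2⟩)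
  refine (pi_norm_le_iff_of_nonneg (by positivity)).2 fun y => ?_
  rw [Pi.sub_apply, expPicard, expPicard, ← mul_sub, add_sub_add_left_eq_sub,
    ← intervalIntegral.integral_sub (hF.intervalIntegrable_exp_mul hμ s t y)
      (hF.intervalIntegrable_exp_mul hν s t y), ← intervalIntegral.integral_const_mul,
    ← intervalIntegral.integral_const_mul]
  refine intervalIntegral.norm_integral_le_of_norm_le ht.1 (ae_of_all _ fun τ hτ => ?_)
    ((hB.const_mul (2 * K)).intervalIntegrable _ _)
  have hτ' : τ ∈ Icc s r := ⟨hτ.1.le, hτ.2.trans ht.2⟩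
  rw [← mul_sub, ← mul_assoc, ← Real.exp_add, norm_mul, Real.norm_of_nonneg (Real.exp_nonneg _)]
  have he : Real.exp (-K * (t - s) + K * (τ - s)) ≤ 1 :=
    Real.exp_le_one_iff.2 (by nlinarith [hτ.2])
  refine (mul_le_of_le_one_left (norm_nonneg _) he).trans ?_
  have h₁ : ‖μ τ y - ν τ y‖ ≤ B τ := (norm_le_pi_norm (μ τ - ν τ) y).trans (hle τ hτ')
  have h₂ : ‖F τ (μ τ) y - F τ (ν τ) y‖ ≤ K * B τ :=
    (norm_le_pi_norm (F τ (μ τ) - F τ (ν τ)) y).trans ((hF.lipschitz _ _ _ (hνs τ hτ')).trans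
      (mul_le_mul_of_nonneg_left (hle τ hτ') hK))
  calc ‖K * μ τ y + F τ (μ τ) y - (K * ν τ y + F τ (ν τ) y)‖
      = ‖K * (μ τ y - ν τ y) + (F τ (μ τ) y - F τ (ν τ) y)‖ := by ring_nf
    _ ≤ K * ‖μ τ y - ν τ y‖ + ‖F τ (μ τ) y - F τ (ν τ) y‖ := by
      refine (norm_add_le _ _).trans_eq ?_
      rw [norm_mul, Real.norm_of_nonneg hK]
    _ ≤ K * B τ + K * B τ := by gcongr
    _ = 2 * K * B τ := by ring

theorem IsSimplexField.tendsto_expPicard (hF : IsSimplexField K F) {x : ℕ → ℝ → ι → ℝ}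
    (hx : ∀ n, Continuous (x n)) (hxs : ∀ n, ∀ t ∈ Icc s r, x n t ∈ stdSimplex ℝ ι)
    (hμs : ∀ t ∈ Icc s r, μ t ∈ stdSimplex ℝ ι)
    (hlim : ∀ t ∈ Icc s r, Tendsto (fun n => x n t) atTop (𝓝 (μ t))) {t : ℝ} (ht : t ∈ Icc s r)
    (y : ι) : Tendsto (fun n => expPicard K F s m (x n) t y) atTop (𝓝 (expPicard K F s m μ t y)) := by
  have hK := hF.nonneg
  have hsub : ∀ τ ∈ uIoc s t, τ ∈ Icc s r := fun τ hτ => by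
    rw [uIoc_of_le ht.1] at hτ
    exact ⟨hτ.1.le, hτ.2.trans ht.2⟩
  refine Tendsto.const_mul _ (Tendsto.const_add _ ?_)
  refine intervalIntegral.tendsto_integral_filter_of_dominated_convergence
    (fun τ => Real.exp (K * (τ - s)) * (K * 1 + K * 1)) (Eventually.of_forall fun n => ?_)
    (Eventually.of_forall fun n => ae_of_all _ fun τ hτ => ?_)
    ((by fun_prop : Continuous _).intervalIntegrable _ _) (ae_of_all _ fun τ hτ => ?_)
  · exact (intervalIntegrable_iff.1
      (hF.intervalIntegrable_exp_mul (hx n) s t y)).aestronglyMeasurable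
  · have h1 := norm_le_one_of_mem_stdSimplex (hxs n τ (hsub τ hτ))
    rw [norm_mul, Real.norm_of_nonneg (Real.exp_nonneg _)]
    refine mul_le_mul_of_nonneg_left ((norm_add_le _ _).trans (add_le_add ?_ ?_))
      (Real.exp_nonneg _)
    · rw [norm_mul, Real.norm_of_nonneg hK]
      exact mul_le_mul_of_nonneg_left ((norm_le_pi_norm _ y).trans h1) hK
    · exact (norm_le_pi_norm _ y).trans
        ((hF.growth _ _).trans (mul_le_mul_of_nonneg_left h1 hK))
  · have hτ' := hlim τ (hsub τ hτ)
    have hFτ : Tendsto (fun n => F τ (x n τ)) atTop (𝓝 (F τ (μ τ))) := by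
      rw [tendsto_iff_norm_sub_tendsto_zero] at hτ' ⊢
      exact squeeze_zero (fun _ => norm_nonneg _)
        (fun n => hF.lipschitz _ _ _ (hμs τ (hsub τ hτ))) (by simpa using hτ'.const_mul K)
    exact (((tendsto_pi_nhds.1 hτ' y).const_mul K).add (tendsto_pi_nhds.1 hFτ y)).const_mul _

theorem IsSimplexField.exists_isIntegralSolution (hF : IsSimplexField K F) (hsr : s ≤ r)
    (hpos : ∀ t ∈ Icc s r, ∀ w ∈ stdSimplex ℝ ι, ∀ y, 0 ≤ K * w y + F t w y)
    (hsum : ∀ t ∈ Icc s r, ∀ w ∈ stdSimplex ℝ ι, ∑ y, F t w y = 0)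
    (hm : m ∈ stdSimplex ℝ ι) :
    ∃ μ : ℝ → ι → ℝ, IsIntegralSolution F s r m μ ∧ ∀ t ∈ Icc s r, μ t ∈ stdSimplex ℝ ι := by
  have hK := hF.nonneg
  set x : ℕ → ℝ → ι → ℝ := fun n => (expPicard K F s m)^[n] fun _ => m
  have hsucc : ∀ n, x (n + 1) = expPicard K F s m (x n) := fun n =>
    Function.iterate_succ_apply' _ _ _
  have hinv : ∀ n, Continuous (x n) ∧ ∀ t ∈ Icc s r, x n t ∈ stdSimplex ℝ ι := fun n => by
    induction n with
    | zero => exact ⟨continuous_const, fun _ _ => hm⟩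
    | succ n ih =>
      rw [hsucc]
      exact ⟨hF.continuous_expPicard ih.1,
        fun t ht => hF.expPicard_mem_stdSimplex hpos hsum hm ih.1 ih.2 ht⟩
  have hdist : ∀ n, ∀ t ∈ Icc s r,
      ‖x (n + 1) t - x n t‖ ≤ 2 * ((2 * K * (t - s)) ^ n / n.factorial) := fun n => by
    induction n with
    | zero =>
      intro t ht
      have h₁ := norm_le_one_of_mem_stdSimplex ((hinv 1).2 t ht)
      have h₀ := norm_le_one_of_mem_stdSimplex ((hinv 0).2 t ht)
      refine (norm_sub_le _ _).trans ?_
      norm_num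
      linarith
    | succ n ih =>
      intro t ht
      have := hF.norm_expPicard_sub_le (m := m) (hinv (n + 1)).1 (hinv n).1 (hinv n).2
        (B := fun t => 2 * ((2 * K * (t - s)) ^ n / n.factorial)) (by fun_prop) ih ht
      rw [← hsucc, ← hsucc] at this
      refine this.trans_eq ?_
      simp only [mul_pow, intervalIntegral.integral_const_mul, intervalIntegral.integral_div]
      rw [intervalIntegral.integral_comp_sub_right (fun τ => τ ^ n) s, integral_pow,
        Nat.factorial_succ]
      push_cast
      field_simp
      simp
      ring
  have hclip : ∀ t, max s (min r t) ∈ Icc s r := fun t =>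
    ⟨le_max_left _ _, max_le hsr (min_le_left _ _)⟩
  have hex : ∀ t, ∃ v, Tendsto (fun n => x n (max s (min r t))) atTop (𝓝 v) := fun t =>
    cauchySeq_tendsto_of_complete <| cauchySeq_of_dist_le_of_summable _
      (fun n => by
        rw [dist_comm, dist_eq_norm]
        exact hdist n _ (hclip t)) ((Real.summable_pow_div_factorial _).mul_left 2)
  choose μ hμ using hex
  have hμs : ∀ t, μ t ∈ stdSimplex ℝ ι := fun t =>
    (isClosed_stdSimplex ℝ ι).mem_of_tendsto (hμ t)
      (Eventually.of_forall fun n => (hinv n).2 _ (hclip t))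
  have hlim : ∀ t ∈ Icc s r, Tendsto (fun n => x n t) atTop (𝓝 (μ t)) := fun t ht => by
    simpa [min_eq_right ht.2, max_eq_right ht.1] using hμ t
  have hμmeas : Measurable μ := measurable_of_tendsto_metrizable
    (fun n => ((hinv n).1.comp (by fun_prop : Continuous fun t => max s (min r t))).measurable)
    (tendsto_pi_nhds.2 hμ)
  have hfix : ∀ t ∈ Icc s r, ∀ y, μ t y = expPicard K F s m μ t y := fun t ht y => by
    refine tendsto_nhds_unique ((tendsto_pi_nhds.1 (hlim t ht) y).comp (tendsto_add_atTop_nat 1))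
      ((hF.tendsto_expPicard (fun n => (hinv n).1) (fun n => (hinv n).2) (fun t _ => hμs t)
        hlim ht y).congr fun n => ?_)
    rw [← hsucc, Function.comp_apply]
  refine ⟨μ, fun t ht y => ?_, fun t _ => hμs t⟩
  have hFi : IntegrableOn (fun τ => F τ (μ τ) y) (Ioc s t) :=
    hF.integrableOn measurableSet_Ioc (by simp) hμmeas.aemeasurable
      (fun τ _ => norm_le_one_of_mem_stdSimplex (hμs τ)) y
  have hμi : IntegrableOn (fun τ => K * μ τ y) (Ioc s t) := by
    refine Integrable.const_mul (Integrable.of_bound (C := 1)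
      ((measurable_pi_apply y).comp hμmeas).aestronglyMeasurable (ae_of_all _ fun τ => ?_)) K
    exact (norm_le_pi_norm _ y).trans (norm_le_one_of_mem_stdSimplex (hμs τ))
  rw [exp_neg_mul_add_integral_eq (K := K) (c := m y) (u := fun τ => μ τ y)
    (h := fun τ => K * μ τ y + F τ (μ τ) y) ht.1
    ((intervalIntegrable_iff_integrableOn_Ioc_of_le ht.1).2 (hμi.add hFi))
    fun τ hτ => hfix τ ⟨hτ.1, hτ.2.trans ht.2⟩ y]
  simp

end

theorem inSimplex_iff_mem_stdSimplex {d : ℕ} {S : Set (Euc d)} [Fintype ↥S] {μ : S → ℝ} :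
    InSimplex S μ ↔ μ ∈ stdSimplex ℝ S :=
  and_congr_right fun _ => ⟨fun h => (hasSum_fintype μ).unique h, fun h => h ▸ hasSum_fintype μ⟩

theorem isChainMotion_iff {d : ℕ} {U : Type} [MeasurableSpace U] {S : Set (Euc d)} [Fintype ↥S]
    {Q : ℝ → (S → ℝ) → U → S → S → ℝ} {ζ : S → ℝ → Measure U} {s r : ℝ} (hsr : s ≤ r)
    {m : S → ℝ} {μ : ℝ → S → ℝ} :
    IsChainMotion S Q s r m ζ μ ↔
      IsIntegralSolution (fun t v y => ∑ x, v x * Qbar S Q ζ t v x y) s r m μ := by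
  have hiff : ∀ t ∈ Icc s r, ∀ y : S,
      (μ t y = m y + ∫ t' in Icc s t, ∑' x : S, μ t' x * Qbar S Q ζ t' (μ t') x y) ↔
        μ t y = m y + ∫ τ in s..t, ∑ x, μ τ x * Qbar S Q ζ τ (μ τ) x y := fun t ht y => by
    simp only [tsum_fintype, integral_Icc_eq_integral_Ioc, intervalIntegral.integral_of_le ht.1]
  refine ⟨fun h t ht y => (hiff t ht y).1 (h.2 t ht y), fun h =>
    ⟨funext fun y => ?_, fun t ht y => (hiff t ht y).2 (h t ht y)⟩⟩
  simpa using h s (left_mem_Icc.2 hsr) y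

theorem abs_Qbar_le {d : ℕ} {U : Type} [MeasurableSpace U] [TopologicalSpace U] {S : Set (Euc d)}
    {Q : ℝ → (S → ℝ) → U → S → S → ℝ} {ζ : S → ℝ → Measure U} (hζ : ∀ x, IsFeedback (ζ x)) {C : ℝ}
    (hC : ∀ t μ u (x y : S), |Q t μ u x y| ≤ C) (t : ℝ) (v : S → ℝ) (x y : S) :
    |Qbar S Q ζ t v x y| ≤ C := by
  have := (hζ x).1 t
  simpa [Qbar] using norm_integral_le_of_norm_le_const (μ := ζ x t)
    (f := fun u => Q t v u x y) (ae_of_all _ fun u => hC t v u x y)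

section

variable {d : ℕ} {U : Type} [MetricSpace U] [CompactSpace U] [MeasurableSpace U] [BorelSpace U]
  {S : Set (Euc d)} {Q : ℝ → (S → ℝ) → U → S → S → ℝ} {ζ : S → ℝ → Measure U}

theorem measurable_Qbar [Finite ↥S]
    (hQ : ∀ x y : S, Continuous fun p : ℝ × (S → ℝ) × U => Q p.1 p.2.1 p.2.2 x y)
    (hζ : ∀ x, IsFeedback (ζ x)) {μ : ℝ → S → ℝ} (hμ : Measurable μ) (x y : S) :
    Measurable fun t => Qbar S Q ζ t (μ t) x y := by
  let κ : ProbabilityTheory.Kernel ℝ U := ⟨ζ x, (hζ x).measurable⟩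
  have : ProbabilityTheory.IsMarkovKernel κ := ⟨(hζ x).1⟩
  have hm : Measurable fun p : ℝ × U => Q p.1 (μ p.1) p.2 x y :=
    (hQ x y).measurable.comp (measurable_fst.prodMk ((hμ.comp measurable_fst).prodMk measurable_snd))
  exact (hm.stronglyMeasurable.integral_kernel_prod_right' (κ := κ)).measurable

theorem integrable_rate
    (hQ : ∀ x y : S, Continuous fun p : ℝ × (S → ℝ) × U => Q p.1 p.2.1 p.2.2 x y)
    (hζ : ∀ x, IsFeedback (ζ x)) (t : ℝ) (v : S → ℝ) (x y : S) :
    Integrable (fun u => Q t v u x y) (ζ x t) := by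
  have := (hζ x).1 t
  have hc : Continuous fun u => Q t v u x y :=
    (hQ x y).comp (by fun_prop : Continuous fun u : U => (t, v, u))
  exact hc.integrable_of_hasCompactSupport (HasCompactSupport.of_compactSpace _)

theorem abs_Qbar_sub_le
    (hQ : ∀ x y : S, Continuous fun p : ℝ × (S → ℝ) × U => Q p.1 p.2.1 p.2.2 x y)
    (hζ : ∀ x, IsFeedback (ζ x)) {t : ℝ} {v w : S → ℝ} {x y : S} {B : ℝ}
    (hB : ∀ u, |Q t v u x y - Q t w u x y| ≤ B) :
    |Qbar S Q ζ t v x y - Qbar S Q ζ t w x y| ≤ B := by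
  have := (hζ x).1 t
  rw [Qbar, Qbar, ← integral_sub (integrable_rate hQ hζ t v x y) (integrable_rate hQ hζ t w x y)]
  simpa using norm_integral_le_of_norm_le_const (μ := ζ x t)
    (f := fun u => Q t v u x y - Q t w u x y) (ae_of_all _ hB)

theorem sum_Qbar_eq_zero [Fintype ↥S]
    (hQ : ∀ x y : S, Continuous fun p : ℝ × (S → ℝ) × U => Q p.1 p.2.1 p.2.2 x y)
    (hζ : ∀ x, IsFeedback (ζ x)) {t : ℝ} {v : S → ℝ} {x : S}
    (h : ∀ u, ∑ y, Q t v u x y = 0) : ∑ y, Qbar S Q ζ t v x y = 0 := by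
  simp only [Qbar, ← integral_finsetSum _ fun y _ => integrable_rate hQ hζ t v x y, h,
    integral_zero]

theorem isSimplexField_kolmogorov [Fintype ↥S]
    (hQ : ∀ x y : S, Continuous fun p : ℝ × (S → ℝ) × U => Q p.1 p.2.1 p.2.2 x y)
    (hζ : ∀ x, IsFeedback (ζ x)) {C L : ℝ} (hC0 : 0 ≤ C)
    (hC : ∀ t μ u (x y : S), |Q t μ u x y| ≤ C) (hL0 : 0 ≤ L)
    (hL : ∀ t u (x y : S) (μ μ' : S → ℝ), |Q t μ u x y - Q t μ' u x y| ≤ L * dist μ μ') :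
    IsSimplexField (Fintype.card S * C + L + C)
      fun t v y => ∑ x, v x * Qbar S Q ζ t v x y where
  nonneg := by positivity
  measurable μ hμ y := by
    have := fun x => measurable_Qbar hQ hζ hμ x y
    fun_prop
  growth t v := by
    refine (pi_norm_le_iff_of_nonneg (by positivity)).2 fun y => ?_
    calc ‖∑ x, v x * Qbar S Q ζ t v x y‖ ≤ ∑ _x : S, ‖v‖ * C := by
          refine norm_sum_le_of_le _ fun x _ => ?_
          rw [norm_mul]
          gcongr
          · exact norm_le_pi_norm v x
          · exact abs_Qbar_le hζ hC t v x y
      _ = Fintype.card S * C * ‖v‖ := by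
          rw [Finset.sum_const, Finset.card_univ, nsmul_eq_mul]
          ring
      _ ≤ _ := mul_le_mul_of_nonneg_right (by linarith) (norm_nonneg _)
  lipschitz t v w hw := by
    refine (pi_norm_le_iff_of_nonneg (by positivity)).2 fun y => ?_
    calc ‖∑ x, v x * Qbar S Q ζ t v x y - ∑ x, w x * Qbar S Q ζ t w x y‖
        = ‖∑ x, ((v x - w x) * Qbar S Q ζ t v x y
            + w x * (Qbar S Q ζ t v x y - Qbar S Q ζ t w x y))‖ := by
          rw [← Finset.sum_sub_distrib]
          congr 1
          exact Finset.sum_congr rfl fun x _ => by ring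
      _ ≤ ∑ x : S, (‖v - w‖ * C + w x * (L * ‖v - w‖)) := by
          refine norm_sum_le_of_le _ fun x _ => (norm_add_le _ _).trans ?_
          rw [norm_mul, norm_mul, Real.norm_of_nonneg (hw.1 x)]
          gcongr
          · exact norm_le_pi_norm (v - w) x
          · exact abs_Qbar_le hζ hC t v x y
          · exact hw.1 x
          · exact abs_Qbar_sub_le hQ hζ fun u => dist_eq_norm v w ▸ hL t u x y v w
      _ = (Fintype.card S * C + L) * ‖v - w‖ := by
          rw [Finset.sum_add_distrib, ← Finset.sum_mul _ w, hw.2, Finset.sum_const,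
            Finset.card_univ, nsmul_eq_mul]
          ring
      _ ≤ _ := mul_le_mul_of_nonneg_right (by linarith) (norm_nonneg _)

end

end

/-- well-posedness of the nonlinear Kolmogorov equation for finite `S`: if
`S` is finite and the entries of the Kolmogorov matrix `Q` are continuous, bounded and
Lipschitz continuous in `μ` uniformly in `(t,u)`, then for every `0 ≤ s < r ≤ T`, every
`μ* ∈ Σ` and every feedback control `ζ_S`, the equation
`dμ_ȳ(t)/dt = Σ_x̄ μ_x̄(t) 𝒬_{x̄,ȳ}(t,μ(t),ζ_S)`, `μ(s)=μ*`, has a unique absolutely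
continuous solution on `[s,r]`, and this solution stays in the simplex. -/
theorem kolmogorov_equation_wellposed
    {d : ℕ} {U : Type} [MetricSpace U] [CompactSpace U] [MeasurableSpace U] [BorelSpace U]
    (T : ℝ) (hT : 0 < T)
    (S : Set (Euc d)) [Fintype ↥S]
    (Q : ℝ → (S → ℝ) → U → S → S → ℝ)
    -- `Q` is a Kolmogorov matrix on the simplex:
    (hQkol : ∀ t ∈ Icc 0 T, ∀ μ : S → ℝ, InSimplex S μ → ∀ (u : U) (x : S),
      (∀ y, x ≠ y → 0 ≤ Q t μ u x y) ∧ HasSum (Q t μ u x) 0)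
    -- continuity of the entries:
    (hQcont : ∀ x y : S, Continuous fun p : ℝ × (S → ℝ) × U => Q p.1 p.2.1 p.2.2 x y)
    -- boundedness of the entries:
    (hQbdd : ∃ C : ℝ, ∀ t μ u (x y : S), |Q t μ u x y| ≤ C)
    -- Lipschitz continuity in `μ`, uniformly in `(t,u)`:
    (hQlip : ∃ L : ℝ, ∀ t u (x y : S) (μ μ' : S → ℝ),
      |Q t μ u x y - Q t μ' u x y| ≤ L * dist μ μ')
    (s r : ℝ) (hs : 0 ≤ s) (hsr : s < r) (hrT : r ≤ T)
    (μstar : S → ℝ) (hμstar : InSimplex S μstar)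
    (ζ : S → ℝ → Measure U) (hζ : ∀ x : S, IsFeedback (ζ x)) :
    ∃ μ : ℝ → S → ℝ,
      IsChainMotion S Q s r μstar ζ μ ∧
      (∀ t ∈ Icc s r, InSimplex S (μ t)) ∧
      ∀ μ' : ℝ → S → ℝ, IsChainMotion S Q s r μstar ζ μ' →
        ∀ t ∈ Icc s r, μ' t = μ t := by
  obtain ⟨C, hC⟩ := hQbdd
  obtain ⟨L, hL⟩ := hQlip
  replace hC : ∀ t μ u (x y : S), |Q t μ u x y| ≤ |C| := fun t μ u x y =>
    (hC t μ u x y).trans (le_abs_self C)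
  replace hL : ∀ t u (x y : S) (μ μ' : S → ℝ), |Q t μ u x y - Q t μ' u x y| ≤ |L| * dist μ μ' :=
    fun t u x y μ μ' => (hL t u x y μ μ').trans
      (mul_le_mul_of_nonneg_right (le_abs_self L) dist_nonneg)
  have hF := isSimplexField_kolmogorov hQcont hζ (abs_nonneg C) hC (abs_nonneg L) hL
  have hI : ∀ t ∈ Icc s r, t ∈ Icc 0 T := fun t ht => ⟨hs.trans ht.1, ht.2.trans hrT⟩
  have hpos : ∀ t ∈ Icc s r, ∀ w ∈ stdSimplex ℝ S, ∀ y,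
      0 ≤ (Fintype.card S * |C| + |L| + |C|) * w y + ∑ x, w x * Qbar S Q ζ t w x y := by
    intro t ht w hw y
    have hk := hQkol t (hI t ht) w (inSimplex_iff_mem_stdSimplex.2 hw)
    have hoff : ∀ x ∈ Finset.univ.erase y, 0 ≤ w x * Qbar S Q ζ t w x y := fun x hx =>
      mul_nonneg (hw.1 x) (integral_nonneg fun u => (hk u x).1 y (Finset.ne_of_mem_erase hx))
    rw [← Finset.add_sum_erase _ _ (Finset.mem_univ y)]
    have hdiag := neg_le_of_abs_le (abs_Qbar_le hζ hC t w y y)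
    have hcoef : 0 ≤ Fintype.card S * |C| + |L| := by positivity
    nlinarith [Finset.sum_nonneg hoff, mul_nonneg (hw.1 y) hcoef,
      mul_le_mul_of_nonneg_left hdiag (hw.1 y)]
  have hsum : ∀ t ∈ Icc s r, ∀ w ∈ stdSimplex ℝ S, ∑ y, ∑ x, w x * Qbar S Q ζ t w x y = 0 := by
    intro t ht w hw
    have hk := hQkol t (hI t ht) w (inSimplex_iff_mem_stdSimplex.2 hw)
    rw [Finset.sum_comm]
    refine Finset.sum_eq_zero fun x _ => ?_
    rw [← Finset.mul_sum, sum_Qbar_eq_zero hQcont hζ fun u =>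
      (hasSum_fintype _).unique (hk u x).2, mul_zero]
  obtain ⟨μ, hμ, hμs⟩ := hF.exists_isIntegralSolution hsr.le hpos hsum
    (inSimplex_iff_mem_stdSimplex.1 hμstar)
  exact ⟨μ, (isChainMotion_iff hsr.le).2 hμ,
    fun t ht => inSimplex_iff_mem_stdSimplex.2 (hμs t ht),
    fun μ' hμ' => ((isChainMotion_iff hsr.le).1 hμ').eqOn hF hμ hμs⟩
end
end

section
/- Let 0≤s<r≤T and let m(·):[s,r]→P²(K) be Borel measurable (in particular supp m(t)⊆K for all t∈[s,r]). Then for every y∈K and every relaxed control ξ∈U_{s,r}: (i) the initial value problem ẋ(t)=∫_U f(t,x(t),m(t),u)ξ(du|t), x(s)=y, has an absolutely continuous solution on [s,r]; (ii) every such solution satisfies x(t)∈K for all t∈[s,r]; and (iii) the solution is unique. -/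
open MeasureTheory Set
open scoped ENNReal NNReal

noncomputable section

lemma measurable_of_forall_continuous_integral {α E : Type*} [MeasurableSpace α]
    [TopologicalSpace E] [MeasurableSpace E] [BorelSpace E] [HasOuterApproxClosed E]
    {m : α → Measure E} [∀ t, IsProbabilityMeasure (m t)]
    (h : ∀ φ : E → ℝ, Continuous φ → (∃ C, ∀ z, |φ z| ≤ C) →
      Measurable fun t => ∫ z, φ z ∂(m t)) : Measurable m := by
  refine Measurable.measure_of_isPiSystem_of_isProbabilityMeasure (S := {s | IsClosed s})
    (BorelSpace.measurable_eq.trans borel_eq_generateFrom_isClosed) isPiSystem_isClosed ?_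
  intro F hF
  refine measurable_of_tendsto_metrizable (f := fun n t => ∫⁻ z, (hF.apprSeq n z : ℝ≥0∞) ∂(m t))
    (fun n => ?_) (tendsto_pi_nhds.2 fun t => HasOuterApproxClosed.tendsto_lintegral_apprSeq hF (m t))
  have key : ∀ t, ∫⁻ z, (hF.apprSeq n z : ℝ≥0∞) ∂(m t)
      = ENNReal.ofReal (∫ z, ((hF.apprSeq n z : ℝ≥0) : ℝ) ∂(m t)) := fun t => by
    rw [← (hF.apprSeq n).toReal_lintegral_coe_eq_integral (m t),
      ENNReal.ofReal_toReal ((hF.apprSeq n).lintegral_lt_top_of_nnreal (m t)).ne]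
  simp_rw [key]
  refine (h _ (NNReal.continuous_coe.comp (hF.apprSeq n).continuous) ⟨1, fun z => ?_⟩).ennreal_ofReal
  rw [Function.comp_apply, abs_of_nonneg (NNReal.coe_nonneg _)]
  exact_mod_cast HasOuterApproxClosed.apprSeq_apply_le_one hF n z

lemma W2sq_le_of_coupling {d : ℕ} {m₁ m₂ : Measure (Euc d)} {π : Measure (Euc d × Euc d)}
    (hπ : π ∈ Couplings m₁ m₂) {C : ℝ≥0∞} (hC : C ≠ ⊤)
    (h : ∫⁻ p, ‖p.1 - p.2‖ₑ ^ 2 ∂π ≤ C) : W2sq m₁ m₂ ≤ C.toReal := by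
  have hbdd : BddBelow ((fun π : Measure (Euc d × Euc d) => ∫ p, ‖p.1 - p.2‖ ^ 2 ∂π) ''
      Couplings m₁ m₂) := ⟨0, by
    rintro _ ⟨π', -, rfl⟩
    exact integral_nonneg fun p => by positivity⟩
  refine (csInf_le hbdd ⟨π, hπ, rfl⟩).trans ?_
  dsimp only
  rw [integral_eq_lintegral_of_nonneg_ae (.of_forall fun p => by positivity)
    (by fun_prop : Continuous fun p : Euc d × Euc d => ‖p.1 - p.2‖ ^ 2).aestronglyMeasurable]
  refine ENNReal.toReal_mono hC (le_trans (le_of_eq (lintegral_congr fun p => ?_)) h)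
  rw [ENNReal.ofReal_pow (norm_nonneg _), ofReal_norm]

lemma W2_le_map {d : ℕ} {m : Measure (Euc d)} [IsProbabilityMeasure m] {g : Euc d → Euc d}
    (hg : Measurable g) (h : ∫⁻ x, ‖g x - x‖ₑ ^ 2 ∂m ≠ ⊤) :
    W2 m (m.map g) ≤ Real.sqrt (∫⁻ x, ‖g x - x‖ₑ ^ 2 ∂m).toReal := by
  have hgm : Measurable fun x => (x, g x) := measurable_id.prodMk hg
  refine Real.sqrt_le_sqrt (W2sq_le_of_coupling (π := m.map fun x => (x, g x)) ⟨?_, ?_, ?_⟩ h ?_)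
  · exact Measure.isProbabilityMeasure_map hgm.aemeasurable
  · rw [Measure.map_map measurable_fst hgm]; exact Measure.map_id
  · rw [Measure.map_map measurable_snd hgm]; rfl
  · rw [lintegral_map (by fun_prop) hgm]
    simp only [enorm_sub_rev (g _), le_refl]

lemma W2_self {d : ℕ} (m : Measure (Euc d)) [IsProbabilityMeasure m] : W2 m m = 0 := by
  have h := W2_le_map (m := m) (g := id) measurable_id (by simp)
  simp only [Measure.map_id, id, sub_self, enorm_zero] at h
  exact le_antisymm (by simpa using h) (Real.sqrt_nonneg _)

/-- Coupling along the common part of two measures carried by a ball. -/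
lemma W2sq_add_le {d : ℕ} {l a b : Measure (Euc d)} {M : ℝ≥0}
    [IsProbabilityMeasure (l + a)] [IsProbabilityMeasure (l + b)]
    (ha : ∀ᵐ x ∂a, ‖x‖ₑ ≤ M) (hb : ∀ᵐ x ∂b, ‖x‖ₑ ≤ M) :
    W2sq (l + a) (l + b) ≤ (a univ * (2 * M) ^ 2).toReal := by
  have hl1 : (l + a) univ = 1 := measure_univ
  have hl2 : (l + b) univ = 1 := measure_univ
  have : IsFiniteMeasure l := isFiniteMeasure_of_le (l + a) (Measure.le_add_right le_rfl)
  have : IsFiniteMeasure a := isFiniteMeasure_of_le (l + a) (Measure.le_add_left le_rfl)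
  have : IsFiniteMeasure b := isFiniteMeasure_of_le (l + b) (Measure.le_add_left le_rfl)
  have hab : a univ = b univ := by
    rw [Measure.add_apply] at hl1 hl2
    exact (ENNReal.add_right_inj (measure_ne_top l univ)).1 (hl1.trans hl2.symm)
  have hd : Measurable fun x : Euc d => (x, x) := by fun_prop
  have hsm : ∀ ν : Measure (Euc d), ν univ = a univ → (a univ)⁻¹ • a univ • ν = ν := by
    intro ν hν
    rcases eq_or_ne (a univ) 0 with h0 | h0
    · rw [h0, Measure.measure_univ_eq_zero] at hν; simp [hν]
    · rw [smul_smul, ENNReal.inv_mul_cancel h0 (measure_ne_top _ _), one_smul]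
  have hfst : (l.map (fun x => (x, x)) + (a univ)⁻¹ • a.prod b).map Prod.fst = l + a := by
    rw [Measure.map_add _ _ measurable_fst, Measure.map_smul, Measure.map_fst_prod,
      Measure.map_map measurable_fst hd, ← hab, hsm a rfl]
    congr 1; exact Measure.map_id
  refine W2sq_le_of_coupling
    (π := l.map (fun x => (x, x)) + (a univ)⁻¹ • a.prod b) ⟨⟨?_⟩, hfst, ?_⟩ (by finiteness) ?_
  · rw [← hl1, ← hfst, Measure.map_apply measurable_fst MeasurableSet.univ, preimage_univ]
  · rw [Measure.map_add _ _ measurable_snd, Measure.map_smul, Measure.map_snd_prod,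
      Measure.map_map measurable_snd hd, hsm b hab.symm]
    congr 1; exact Measure.map_id
  · rw [lintegral_add_measure, lintegral_map (by fun_prop) hd, lintegral_smul_measure,
      lintegral_prod _ (by fun_prop)]
    have h1 : ∫⁻ x, ∫⁻ y, ‖x - y‖ₑ ^ 2 ∂b ∂a ≤ ∫⁻ _, ∫⁻ _, (2 * M : ℝ≥0∞) ^ 2 ∂b ∂a := by
      refine lintegral_mono_ae (ha.mono fun x hx => lintegral_mono_ae (hb.mono fun y hy => ?_))
      gcongr
      rw [two_mul]
      exact enorm_sub_le.trans (add_le_add hx hy)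
    simp only [sub_self, enorm_zero, ne_eq, OfNat.ofNat_ne_zero, not_false_eq_true, zero_pow,
      lintegral_const, zero_mul, zero_add, smul_eq_mul] at h1 ⊢
    refine (mul_le_mul_right h1 _).trans ?_
    rw [← hab]
    rcases eq_or_ne (a univ) 0 with h0 | h0
    · simp [h0]
    · rw [mul_comm _ (a univ), ← mul_assoc (a univ)⁻¹,
        ENNReal.inv_mul_cancel h0 (measure_ne_top _ _), one_mul, mul_comm]

/-- The discrete measure with weights `w` at the points `pt`. -/
def weightedDirac {d : ℕ} {ι : Type*} [Fintype ι] (pt : ι → Euc d) (w : ι → ℝ) :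
    Measure (Euc d) :=
  ∑ i, ENNReal.ofReal (w i) • Measure.dirac (pt i)

section WeightedDirac

variable {d : ℕ} {ι : Type*} [Fintype ι] {pt : ι → Euc d}

lemma weightedDirac_univ {w : ι → ℝ} (hw : ∀ i, 0 ≤ w i) :
    weightedDirac pt w univ = ENNReal.ofReal (∑ i, w i) := by
  simp [weightedDirac, ENNReal.ofReal_sum_of_nonneg fun i _ => hw i]

lemma weightedDirac_add {v w : ι → ℝ} (hv : ∀ i, 0 ≤ v i) (hw : ∀ i, 0 ≤ w i) :
    weightedDirac pt v + weightedDirac pt w = weightedDirac pt (v + w) := by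
  simp only [weightedDirac, ← Finset.sum_add_distrib, ← add_smul, Pi.add_apply,
    ENNReal.ofReal_add (hv _) (hw _)]

lemma ae_weightedDirac {P : Euc d → Prop} (w : ι → ℝ) (h : ∀ i, P (pt i)) :
    ∀ᵐ x ∂(weightedDirac pt w), P x := by
  refine Filter.Eventually.filter_mono (?_ : _ ≤ ae (Measure.sum
    fun i => ENNReal.ofReal (w i) • Measure.dirac (pt i))) ?_
  · rw [weightedDirac, Measure.sum_fintype]
  · refine Measure.ae_sum_iff.2 fun i => Measure.ae_smul_measure ?_ _
    simpa [ae_dirac_eq] using h i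

lemma isProbabilityMeasure_weightedDirac (w : stdSimplex ℝ ι) :
    IsProbabilityMeasure (weightedDirac pt w) :=
  ⟨by rw [weightedDirac_univ (w := w) w.2.1, show ∑ i, w i = 1 from w.2.2, ENNReal.ofReal_one]⟩

lemma exists_enorm_le (pt : ι → Euc d) : ∃ M : ℝ≥0, ∀ i, ‖pt i‖ₑ ≤ M :=
  ⟨∑ i, ‖pt i‖₊, fun i => ENNReal.coe_le_coe.2
    (Finset.single_le_sum (f := fun i => ‖pt i‖₊) (fun _ _ => zero_le) (Finset.mem_univ i))⟩

lemma memP2K_weightedDirac {K : Set (Euc d)} (hpt : ∀ i, pt i ∈ K)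
    (w : stdSimplex ℝ ι) : MemP2K K (weightedDirac pt w) := by
  have := isProbabilityMeasure_weightedDirac (pt := pt) w
  obtain ⟨M, hM⟩ := exists_enorm_le pt
  refine ⟨⟨this, lt_of_le_of_lt (b := (M : ℝ≥0∞) ^ 2) ?_ (by finiteness)⟩, ?_⟩
  · refine (lintegral_mono_ae (g := fun _ => (M : ℝ≥0∞) ^ 2) ?_).trans (by simp)
    exact ae_weightedDirac (P := fun x => (‖x‖₊ : ℝ≥0∞) ^ 2 ≤ (M : ℝ≥0∞) ^ 2) _
      fun i => pow_le_pow_left' (hM i) 2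
  · exact mem_ae_iff.1 (ae_weightedDirac (P := fun x => x ∈ K) w hpt)

lemma tendsto_W2_weightedDirac (w : stdSimplex ℝ ι) :
    Filter.Tendsto (fun v : stdSimplex ℝ ι => W2 (weightedDirac pt v) (weightedDirac pt w))
      (nhds w) (nhds 0) := by
  obtain ⟨M, hM⟩ := exists_enorm_le pt
  have hle : ∀ v : stdSimplex ℝ ι, W2 (weightedDirac pt v) (weightedDirac pt w)
      ≤ Real.sqrt ((∑ i, (v i - min (v i) (w i))) * (2 * M) ^ 2) := by
    intro v
    have hl : ∀ i, 0 ≤ min (v i) (w i) := fun i => le_min (v.2.1 i) (w.2.1 i)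
    have ha : ∀ i, 0 ≤ v i - min (v i) (w i) := fun i => sub_nonneg.2 (min_le_left _ _)
    have hb : ∀ i, 0 ≤ w i - min (v i) (w i) := fun i => sub_nonneg.2 (min_le_right _ _)
    have hv : weightedDirac pt (fun i => min (v i) (w i))
        + weightedDirac pt (fun i => v i - min (v i) (w i)) = weightedDirac pt v := by
      rw [weightedDirac_add hl ha]; congr 1; ext i; simp
    have hw : weightedDirac pt (fun i => min (v i) (w i))
        + weightedDirac pt (fun i => w i - min (v i) (w i)) = weightedDirac pt w := by
      rw [weightedDirac_add hl hb]; congr 1; ext i; simp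
    have := isProbabilityMeasure_weightedDirac (pt := pt) v
    have := isProbabilityMeasure_weightedDirac (pt := pt) w
    rw [← hv, ← hw] at *
    refine Real.sqrt_le_sqrt ((W2sq_add_le (M := M) (ae_weightedDirac _ hM)
      (ae_weightedDirac _ hM)).trans (le_of_eq ?_))
    rw [weightedDirac_univ ha, ENNReal.toReal_mul,
      ENNReal.toReal_ofReal (Finset.sum_nonneg fun i _ => ha i)]
    simp
  refine squeeze_zero (fun _ => Real.sqrt_nonneg _) hle ?_
  have hc : Continuous fun v : stdSimplex ℝ ι =>
      Real.sqrt ((∑ i, (v i - min (v i) (w i))) * (2 * M) ^ 2) := by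
    have : ∀ i, Continuous fun v : stdSimplex ℝ ι => v i := fun i =>
      (continuous_apply i).comp continuous_subtype_val
    exact Real.continuous_sqrt.comp ((continuous_finsetSum _ fun i _ =>
      (this i).sub ((this i).min continuous_const)).mul continuous_const)
  simpa using hc.tendsto w

end WeightedDirac

section Dynamics

variable {d : ℕ} {U : Type} [MetricSpace U] [CompactSpace U] [MeasurableSpace U] [BorelSpace U]
  {T R Cf : ℝ} {K : Set (Euc d)} {f : ℝ → Euc d → Measure (Euc d) → U → Euc d}
  {m : ℝ → Measure (Euc d)} {x : ℝ → Euc d}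

lemma measurable_indicator_map_simpleFunc (hK : IsClosed K)
    (hf : DynHyp T R Cf K f) (hm : Measurable m) [∀ t, IsProbabilityMeasure (m t)]
    (hx : Continuous x) (g : SimpleFunc (Euc d) (Euc d)) (hg : ∀ z, g z ∈ K) :
    Measurable ({p : ℝ × U | p.1 ∈ Icc 0 T ∧ x p.1 ∈ K}.indicator
      fun p => f p.1 (x p.1) ((m p.1).map g) p.2) := by
  set A : Set (ℝ × U) := {p | p.1 ∈ Icc 0 T ∧ x p.1 ∈ K} with hA
  have hAm : MeasurableSet A :=
    (measurable_fst measurableSet_Icc).inter ((hx.measurable.comp measurable_fst) hK.measurableSet)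
  let pt : g.range → Euc d := Subtype.val
  have hpt : ∀ i, pt i ∈ K := by
    rintro ⟨i, hi⟩
    obtain ⟨z, rfl⟩ := SimpleFunc.mem_range.1 hi
    exact hg z
  have hsum : ∀ t, ∑ i : g.range, (m t) (g ⁻¹' {i.1}) = 1 := fun t => by
    rw [Finset.sum_coe_sort g.range fun i => (m t) (g ⁻¹' {i}),
      g.sum_range_measure_preimage_singleton,
      measure_univ]
  let wt : ℝ → stdSimplex ℝ g.range := fun t =>
    ⟨fun i => ((m t) (g ⁻¹' {i.1})).toReal, fun _ => ENNReal.toReal_nonneg, by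
      rw [← ENNReal.toReal_sum fun _ _ => measure_ne_top _ _, hsum, ENNReal.toReal_one]⟩
  have hwt : Measurable wt := Measurable.subtype_mk (measurable_pi_lambda _ fun i =>
    ((Measure.measurable_coe (g.measurableSet_preimage _)).comp hm).ennreal_toReal)
  have hmap : ∀ t, (m t).map g = weightedDirac pt (wt t) := fun t => by
    ext B hB
    have h1 : (m t) (g ⁻¹' B) = (g.map (B.indicator (1 : Euc d → ℝ≥0∞))).lintegral (m t) := by
      rw [← SimpleFunc.lintegral_eq_lintegral, ← lintegral_indicator_one (g.measurable hB)]
      rfl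
    rw [Measure.map_apply g.measurable hB, h1, SimpleFunc.map_lintegral, weightedDirac,
      Measure.finsetSum_apply, ← Finset.sum_coe_sort g.range]
    refine Finset.sum_congr rfl fun i _ => ?_
    rw [Measure.smul_apply, Measure.dirac_apply' _ hB, smul_eq_mul, mul_comm,
      show wt t i = ((m t) (g ⁻¹' {i.1})).toReal from rfl,
      ENNReal.ofReal_toReal (measure_ne_top _ _)]
  let u : stdSimplex ℝ g.range → ℝ × U → Euc d := fun w =>
    A.indicator fun p => f p.1 (x p.1) (weightedDirac pt w) p.2
  have hu : Measurable (Function.uncurry u) := by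
    refine measurable_uncurry_of_continuous_of_measurable (fun p => ?_) fun w => ?_
    · by_cases hp : p ∈ A
      · simp only [u, indicator_of_mem hp]
        refine continuous_iff_continuousAt.2 fun w => tendsto_iff_norm_sub_tendsto_zero.2 ?_
        have := (tendsto_W2_weightedDirac (pt := pt) w).const_mul Cf
        rw [mul_zero] at this
        refine squeeze_zero (fun _ => norm_nonneg _) (fun v => ?_) this
        have := hf.lipschitz p.1 (x p.1) (x p.1) _ _ p.2 hp.1 hp.2 hp.2
          (memP2K_weightedDirac hpt v) (memP2K_weightedDirac hpt w)
        simpa using this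
      · simp only [u, indicator_of_notMem hp]
        exact continuous_const
    · refine Measurable.indicator ?_ hAm
      exact ((hf.cont (weightedDirac pt w)).comp
        (continuous_fst.prodMk ((hx.comp continuous_fst).prodMk continuous_snd))).measurable
  convert hu.comp ((hwt.comp measurable_fst).prodMk measurable_id) using 1
  ext1 p
  simp only [u, Function.comp_def, Function.uncurry, id, ← hmap]
  rfl

lemma measurable_indicator_dynamics (hCf : 0 < Cf) (hK : IsClosed K)
    (hf : DynHyp T R Cf K f) (hm : Measurable m) (hmP : ∀ t, MemP2K K (m t))
    (hKne : K.Nonempty) (hx : Continuous x) :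
    Measurable ({p : ℝ × U | p.1 ∈ Icc 0 T ∧ x p.1 ∈ K}.indicator
      fun p => f p.1 (x p.1) (m p.1) p.2) := by
  obtain ⟨y, hy⟩ := hKne
  have := fun t => (hmP t).1.1
  let g : ℕ → SimpleFunc (Euc d) (Euc d) := SimpleFunc.approxOn id measurable_id K y hy
  have hg : ∀ n z, g n z ∈ K := fun n z => SimpleFunc.approxOn_mem measurable_id hy n z
  refine measurable_of_tendsto_metrizable (fun n =>
    measurable_indicator_map_simpleFunc hK hf hm hx (g n) (hg n))
    (tendsto_pi_nhds.2 fun p => ?_)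
  by_cases hp : p.1 ∈ Icc 0 T ∧ x p.1 ∈ K
  swap
  · simp only [indicator_of_notMem (s := {p : ℝ × U | p.1 ∈ Icc 0 T ∧ x p.1 ∈ K}) hp]
    exact tendsto_const_nhds
  simp only [indicator_of_mem (s := {p : ℝ × U | p.1 ∈ Icc 0 T ∧ x p.1 ∈ K}) hp]
  have hmem : MemLp id 2 (m p.1) := by
    refine ⟨aestronglyMeasurable_id, ?_⟩
    have h2 := eLpNorm_nnreal_pow_eq_lintegral (f := (id : Euc d → Euc d)) (μ := m p.1)
      (p := 2) two_ne_zero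
    have h3 := (hmP p.1).1.2
    have : eLpNorm id (2 : ℝ≥0) (m p.1) ^ ((2 : ℝ≥0) : ℝ) < ⊤ := by
      rw [h2]; simpa [enorm_eq_nnnorm] using h3
    simpa using this
  have hlim := SimpleFunc.tendsto_approxOn_Lp_eLpNorm (p := 2) measurable_id hy (by simp)
    (μ := m p.1) (s := K) (by
      filter_upwards [show ∀ᵐ z ∂(m p.1), z ∈ K from mem_ae_iff.2 (hmP p.1).2] with z hz
      exact subset_closure hz) (hmem.sub (memLp_const y)).eLpNorm_lt_top
  have hint : ∀ n, ∫⁻ z, ‖g n z - z‖ₑ ^ 2 ∂(m p.1)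
      = eLpNorm (⇑(g n) - id) 2 (m p.1) ^ 2 := fun n => by
    have := eLpNorm_nnreal_pow_eq_lintegral (f := (⇑(g n) - id : Euc d → Euc d)) (μ := m p.1)
      (p := 2) two_ne_zero
    simpa using this.symm
  have hgL : ∀ n, MemLp (⇑(g n)) 2 (m p.1) := fun n =>
    (SimpleFunc.memLp_top (g n) (m p.1)).mono_exponent le_top
  have hgP : ∀ n, MemP2K K ((m p.1).map (g n)) := fun n => by
    refine ⟨⟨Measure.isProbabilityMeasure_map (g n).measurable.aemeasurable, ?_⟩, ?_⟩
    · rw [lintegral_map (by fun_prop) (g n).measurable]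
      have h2 := eLpNorm_nnreal_pow_eq_lintegral (f := ⇑(g n)) (μ := m p.1) (p := 2) two_ne_zero
      have : eLpNorm (⇑(g n)) (2 : ℝ≥0) (m p.1) ^ ((2 : ℝ≥0) : ℝ) < ⊤ :=
        ENNReal.rpow_lt_top_of_nonneg (by simp) (by simpa using (hgL n).eLpNorm_ne_top)
      rw [h2] at this
      simpa [enorm_eq_nnnorm] using this
    · rw [SuppIn, Measure.map_apply (g n).measurable hK.measurableSet.compl]
      convert measure_empty (μ := m p.1)
      ext z; simp [hg n z]
  have hW : ∀ n, W2 (m p.1) ((m p.1).map (g n)) ≤ (eLpNorm (⇑(g n) - id) 2 (m p.1)).toReal :=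
    fun n => by
    have hne : eLpNorm (⇑(g n) - id) 2 (m p.1) ≠ ⊤ := ((hgL n).sub hmem).eLpNorm_ne_top
    refine (W2_le_map (g n).measurable (by rw [hint]; finiteness)).trans ?_
    rw [hint, ENNReal.toReal_pow, Real.sqrt_sq ENNReal.toReal_nonneg]
  refine tendsto_iff_norm_sub_tendsto_zero.2 ?_
  have hlim' := ((ENNReal.tendsto_toReal ENNReal.zero_ne_top).comp hlim).const_mul Cf
  rw [ENNReal.toReal_zero, mul_zero] at hlim'
  refine squeeze_zero (fun _ => norm_nonneg _) (fun n => ?_) hlim'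
  rw [norm_sub_rev]
  refine (hf.lipschitz p.1 (x p.1) (x p.1) _ _ p.2 hp.1 hp.2 hp.2 (hmP p.1) (hgP n)).trans ?_
  rw [sub_self, norm_zero, zero_add]
  exact mul_le_mul_of_nonneg_left (hW n) hCf.le

end Dynamics

lemma isFiniteMeasure_of_map_fst {U : Type*} [MeasurableSpace U] {s r : ℝ}
    {ξ : Measure (ℝ × U)} (hξ : ξ.map Prod.fst = volume.restrict (Icc s r)) :
    IsFiniteMeasure ξ := by
  refine ⟨?_⟩
  rw [← preimage_univ (f := Prod.fst), ← Measure.map_apply measurable_fst MeasurableSet.univ, hξ]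
  exact measure_lt_top _ _

lemma ae_fst_mem_Icc {U : Type*} [MeasurableSpace U] {s r : ℝ} {ξ : Measure (ℝ × U)}
    (hξ : ξ.map Prod.fst = volume.restrict (Icc s r)) :
    ∀ᵐ p ∂ξ, p.1 ∈ Icc s r := by
  refine ae_of_ae_map measurable_fst.aemeasurable (p := fun t => t ∈ Icc s r) ?_
  rw [hξ]
  exact ae_restrict_mem measurableSet_Icc

lemma integrable_of_bound_fst {E U : Type*} [NormedAddCommGroup E] [MeasurableSpace U]
    {s r : ℝ} {ξ : Measure (ℝ × U)} (hξ : ξ.map Prod.fst = volume.restrict (Icc s r)) {R : ℝ}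
    {h : ℝ × U → E} (hm : AEStronglyMeasurable h ξ) (hb : ∀ p : ℝ × U, p.1 ∈ Icc s r → ‖h p‖ ≤ R) :
    Integrable h ξ := by
  have := isFiniteMeasure_of_map_fst hξ
  exact .of_bound hm R ((ae_fst_mem_Icc hξ).mono hb)

section RelaxedODE

variable {E U : Type*} [NormedAddCommGroup E] [NormedSpace ℝ E] [MeasurableSpace U]
  {s r : ℝ} {ξ : Measure (ℝ × U)}

lemma norm_setIntegral_prod_univ_le (hξ : ξ.map Prod.fst = volume.restrict (Icc s r))
    {a b : ℝ} (hsa : s ≤ a) (hab : a ≤ b) (hbr : b ≤ r) {h : ℝ × U → E} {g : ℝ → ℝ}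
    (hg : Continuous g) {I : Set ℝ} (hI : MeasurableSet I) (hIab : I ⊆ Icc a b)
    (hle : ∀ p : ℝ × U, p.1 ∈ I → ‖h p‖ ≤ g p.1) (hg0 : ∀ t ∈ Icc a b, 0 ≤ g t) :
    ‖∫ p in I ×ˢ (univ : Set U), h p ∂ξ‖ ≤ ∫ t in a..b, g t := by
  have hIm : MeasurableSet (I ×ˢ (univ : Set U)) := hI.prod MeasurableSet.univ
  have hpre : I ×ˢ (univ : Set U) = Prod.fst ⁻¹' I := by ext; simp
  have hIsr : I ⊆ Icc s r := hIab.trans (Icc_subset_Icc hsa hbr)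
  have hr : (volume.restrict (Icc s r)).restrict I = volume.restrict I := by
    rw [Measure.restrict_restrict hI, inter_eq_self_of_subset_left hIsr]
  have hgi : IntegrableOn g (Icc a b) := hg.integrableOn_Icc
  have hint : IntegrableOn (fun p : ℝ × U => g p.1) (I ×ˢ univ) ξ := by
    have hgI : Integrable g ((ξ.restrict (Prod.fst ⁻¹' I)).map Prod.fst) := by
      rw [← Measure.restrict_map measurable_fst hI, hξ, hr]
      exact hgi.mono_set hIab
    rw [hpre]
    exact hgI.comp_measurable measurable_fst
  calc ‖∫ p in I ×ˢ (univ : Set U), h p ∂ξ‖ ≤ ∫ p in I ×ˢ (univ : Set U), g p.1 ∂ξ :=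
        norm_integral_le_of_norm_le hint (ae_restrict_of_forall_mem hIm fun p hp => hle p hp.1)
    _ = ∫ t in I, g t := by
        rw [hpre, ← setIntegral_map hI (hξ ▸ hg.aestronglyMeasurable) measurable_fst.aemeasurable,
          hξ, hr]
    _ ≤ ∫ t in Icc a b, g t := setIntegral_mono_set hgi
        (ae_restrict_of_forall_mem measurableSet_Icc hg0) hIab.eventuallyLE
    _ = ∫ t in a..b, g t := by
        rw [integral_Icc_eq_integral_Ioc, intervalIntegral.integral_of_le hab]

lemma setIntegral_Icc_sub {h : ℝ × U → E} (hint : Integrable h ξ) {a b : ℝ} (hsa : s ≤ a)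
    (hab : a ≤ b) :
    (∫ p in Icc s b ×ˢ (univ : Set U), h p ∂ξ) - ∫ p in Icc s a ×ˢ (univ : Set U), h p ∂ξ
      = ∫ p in Ioc a b ×ˢ (univ : Set U), h p ∂ξ := by
  have hdiff : (Icc s b ×ˢ (univ : Set U)) \ (Icc s a ×ˢ univ) = Ioc a b ×ˢ univ := by
    ext p
    simp only [mem_sdiff, mem_prod, mem_Icc, mem_univ, and_true, mem_Ioc, not_and, not_le]
    exact ⟨fun h => ⟨h.2 h.1.1, h.1.2⟩, fun h => ⟨⟨hsa.trans h.1.le, h.2⟩, fun _ => h.1⟩⟩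
  rw [← setIntegral_sdiff (measurableSet_Icc.prod MeasurableSet.univ) hint.integrableOn
    (prod_mono (Icc_subset_Icc_right hab) subset_rfl), hdiff]

lemma norm_setIntegral_Icc_sub_le (hξ : ξ.map Prod.fst = volume.restrict (Icc s r)) {R : ℝ}
    (hR : 0 ≤ R) {h : ℝ × U → E} (hint : Integrable h ξ)
    (hb : ∀ p : ℝ × U, p.1 ∈ Icc s r → ‖h p‖ ≤ R) {a b : ℝ} (hsa : s ≤ a) (hab : a ≤ b)
    (hbr : b ≤ r) :
    ‖(∫ p in Icc s b ×ˢ (univ : Set U), h p ∂ξ) - ∫ p in Icc s a ×ˢ (univ : Set U), h p ∂ξ‖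
      ≤ R * (b - a) := by
  rw [setIntegral_Icc_sub hint hsa hab]
  have := norm_setIntegral_prod_univ_le hξ hsa hab hbr (h := h) (g := fun _ => R)
    continuous_const measurableSet_Ioc Ioc_subset_Icc_self
    (fun p hp => hb p ⟨hsa.trans hp.1.le, hp.2.trans hbr⟩) fun _ _ => hR
  simpa [mul_comm] using this

/-- A relaxed Carathéodory integral equation with bounded Lipschitz right-hand side has exactly
one continuous solution. -/
lemma existsUnique_relaxed_integral_equation [CompleteSpace E] (hsr : s ≤ r)
    (hξ : ξ.map Prod.fst = volume.restrict (Icc s r)) {R C : ℝ} (hR : 0 ≤ R) (hC : 0 < C)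
    {F : ℝ → E → U → E}
    (hm : ∀ x : ℝ → E, Continuous x → AEStronglyMeasurable (fun p => F p.1 (x p.1) p.2) ξ)
    (hb : ∀ t ∈ Icc s r, ∀ z u, ‖F t z u‖ ≤ R)
    (hL : ∀ t ∈ Icc s r, ∀ z z' u, ‖F t z u - F t z' u‖ ≤ C * ‖z - z'‖) (y : E) :
    ∃! z : C(Icc s r, E), ∀ t : Icc s r, z t = y +
      ∫ p in Icc s t ×ˢ (univ : Set U), F p.1 (IccExtend hsr z p.1) p.2 ∂ξ := by
  have hext : ∀ z : C(Icc s r, E), Continuous (IccExtend hsr z) := fun z => z.continuous.Icc_extend'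
  have hint : ∀ z : C(Icc s r, E), Integrable (fun p => F p.1 (IccExtend hsr z p.1) p.2) ξ :=
    fun z => integrable_of_bound_fst hξ (hm _ (hext z)) fun p hp => hb _ hp _ _
  let Φ : C(Icc s r, E) → C(Icc s r, E) := fun z =>
    ⟨fun t => y + ∫ p in Icc s t ×ˢ (univ : Set U), F p.1 (IccExtend hsr z p.1) p.2 ∂ξ, by
      refine continuous_const.add (LipschitzWith.of_dist_le' (K := R) fun a b => ?_).continuous
      have hlip := fun a b : Icc s r => norm_setIntegral_Icc_sub_le hξ hR (hint z)
        (fun p hp => hb _ hp _ _) (a := a) (b := b) a.2.1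
      rcases le_total (a : ℝ) b with hab | hab
      · rw [dist_comm, dist_eq_norm, dist_comm, Subtype.dist_eq, Real.dist_eq,
          abs_of_nonneg (sub_nonneg.2 hab)]
        exact hlip a b hab b.2.2
      · rw [dist_eq_norm, Subtype.dist_eq, Real.dist_eq, abs_of_nonneg (sub_nonneg.2 hab)]
        exact hlip b a hab a.2.2⟩
  have hΦ : ∀ z z' D, 0 ≤ D →
      (∀ t : Icc s r, ‖z t - z' t‖ ≤ D * Real.exp (2 * C * (t - s))) →
      ∀ t : Icc s r, ‖Φ z t - Φ z' t‖ ≤ D / 2 * Real.exp (2 * C * (t - s)) := by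
    intro z z' D hD h t
    have hc : Continuous fun τ : ℝ => C * (D * Real.exp (2 * C * (τ - s))) := by fun_prop
    have hderiv : ∀ τ : ℝ, HasDerivAt (fun τ => D / 2 * Real.exp (2 * C * (τ - s)))
        (C * (D * Real.exp (2 * C * (τ - s)))) τ := fun τ => by
      have := ((((hasDerivAt_id τ).sub_const s).const_mul (2 * C)).exp).const_mul (D / 2)
      exact this.congr_deriv (by simp only [id]; ring)
    have hbd := norm_setIntegral_prod_univ_le hξ le_rfl t.2.1 t.2.2
      (h := fun p => F p.1 (IccExtend hsr z p.1) p.2 - F p.1 (IccExtend hsr z' p.1) p.2)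
      hc measurableSet_Icc subset_rfl (fun p hp => by
        have hp' : p.1 ∈ Icc s r := ⟨hp.1, hp.2.trans t.2.2⟩
        refine (hL _ hp' _ _ _).trans ?_
        rw [IccExtend_of_mem _ _ hp', IccExtend_of_mem _ _ hp']
        exact mul_le_mul_of_nonneg_left (h ⟨p.1, hp'⟩) hC.le) fun _ _ => by positivity
    rw [intervalIntegral.integral_eq_sub_of_hasDerivAt (fun τ _ => hderiv τ)
      (hc.intervalIntegrable _ _), integral_sub (hint z).integrableOn (hint z').integrableOn] at hbd
    simp only [Φ, ContinuousMap.coe_mk, add_sub_add_left_eq_sub]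
    refine hbd.trans (sub_le_self _ (by positivity))
  have hiter : ∀ n z z', ∀ t : Icc s r, ‖Φ^[n] z t - Φ^[n] z' t‖
      ≤ dist z z' / 2 ^ n * Real.exp (2 * C * (t - s)) := by
    intro n z z'
    induction n with
    | zero =>
      intro t
      have h1 : ‖z t - z' t‖ ≤ dist z z' := by
        rw [← dist_eq_norm]; exact ContinuousMap.dist_apply_le_dist t
      have h2 : 1 ≤ Real.exp (2 * C * (t - s)) :=
        Real.one_le_exp (mul_nonneg (by positivity) (sub_nonneg.2 t.2.1))
      simpa using h1.trans (le_mul_of_one_le_right dist_nonneg h2)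
    | succ n ih =>
      intro t
      rw [Function.iterate_succ_apply', Function.iterate_succ_apply', pow_succ, ← div_div]
      exact hΦ _ _ _ (by positivity) ih t
  obtain ⟨n, hn⟩ := pow_unbounded_of_one_lt (2 * Real.exp (2 * C * (r - s)))
    (one_lt_two (α := ℝ))
  have hcontr : ContractingWith (1 / 2) Φ^[n] := by
    refine ⟨by norm_num, LipschitzWith.of_dist_le_mul fun z z' => ?_⟩
    refine (ContinuousMap.dist_le (by positivity)).2 fun t => ?_
    rw [dist_eq_norm]
    refine (hiter n z z' t).trans ?_
    have h3 : Real.exp (2 * C * (t - s)) ≤ Real.exp (2 * C * (r - s)) :=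
      Real.exp_le_exp.2 (mul_le_mul_of_nonneg_left (by linarith [t.2.2]) (by positivity))
    rw [div_mul_eq_mul_div, div_le_iff₀ (by positivity)]
    have h4 : Real.exp (2 * C * (t - s)) ≤ 1 / 2 * 2 ^ n := by linarith
    calc dist z z' * Real.exp (2 * C * (t - s)) ≤ dist z z' * (1 / 2 * 2 ^ n) :=
          mul_le_mul_of_nonneg_left h4 dist_nonneg
      _ = _ := by push_cast; ring
  refine ⟨hcontr.fixedPoint Φ^[n], fun t => ?_, fun z hz => ?_⟩
  · exact (DFunLike.congr_fun hcontr.isFixedPt_fixedPoint_iterate t).symm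
  · refine hcontr.fixedPoint_unique (Function.IsFixedPt.iterate ?_ n)
    exact ContinuousMap.ext fun t => (hz t).symm

end RelaxedODE

lemma exists_last_mem {E : Type*} [TopologicalSpace E] {K : Set E} (hK : IsClosed K)
    {γ : ℝ → E} (hγ : Continuous γ) {a b : ℝ} (hab : a ≤ b) (ha : γ a ∈ K) (hb : γ b ∉ K) :
    ∃ c ∈ Ico a b, γ c ∈ K ∧ ∀ t ∈ Ioc c b, γ t ∉ K := by
  have hS : IsCompact (Icc a b ∩ γ ⁻¹' K) := isCompact_Icc.inter_right (hK.preimage hγ)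
  obtain ⟨c, ⟨hc, hcK⟩, hmax⟩ := hS.exists_isGreatest ⟨a, left_mem_Icc.2 hab, ha⟩
  refine ⟨c, ⟨hc.1, lt_of_le_of_ne hc.2 fun h => hb (h ▸ hcK)⟩, hcK, fun t ht htK => ?_⟩
  exact ht.1.not_ge (hmax ⟨⟨hc.1.trans ht.1.le, ht.2⟩, htK⟩)

section Trajectories

variable {d : ℕ} {U : Type} [MetricSpace U] {T R Cf : ℝ} {K : Set (Euc d)}
  {f : ℝ → Euc d → Measure (Euc d) → U → Euc d} {μ : Measure (Euc d)}

lemma norm_dynamics_le (hR : 0 ≤ R) (hf : DynHyp T R Cf K f) {t : ℝ} (ht : t ∈ Icc 0 T)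
    (hμ : MemP2K K μ) (z : Euc d) (u : U) : ‖f t z μ u‖ ≤ R := by
  by_cases hz : z ∈ K
  · exact hf.bounded t z μ u ht hz hμ
  · rw [hf.zero_outside t z μ u hμ.2 hz, norm_zero]; exact hR

lemma norm_dynamics_le_of_notMem (hCf : 0 ≤ Cf) (hK : IsClosed K) (hf : DynHyp T R Cf K f)
    {t : ℝ} (ht : t ∈ Icc 0 T) (hμ : MemP2K K μ) {z z' : Euc d} (hz : z ∈ K) (hz' : z' ∉ K)
    (u : U) : ‖f t z μ u‖ ≤ Cf * ‖z - z'‖ := by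
  have := hμ.1.1
  let γ : ℝ → Euc d := fun τ => z + τ • (z' - z)
  have hγ : Continuous γ := by fun_prop
  obtain ⟨c, hc, hcK, hout⟩ := exists_last_mem hK hγ zero_le_one (by simpa [γ] using hz)
    (by simpa [γ] using hz')
  have hcont : Continuous fun τ => f t (γ τ) μ u :=
    (hf.cont μ).comp (continuous_const.prodMk (hγ.prodMk continuous_const))
  have h0 : f t (γ c) μ u = 0 := by
    have hlim : Filter.Tendsto (fun τ => f t (γ τ) μ u) (nhdsWithin c (Ioi c))
        (nhds (f t (γ c) μ u)) := (hcont.tendsto c).mono_left nhdsWithin_le_nhds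
    refine tendsto_nhds_unique hlim (tendsto_const_nhds.congr' ?_)
    filter_upwards [Ioc_mem_nhdsGT hc.2] with τ hτ
    exact (hf.zero_outside t _ μ u hμ.2 (hout τ hτ)).symm
  have hlip := hf.lipschitz t z (γ c) μ μ u ht hz hcK hμ hμ
  rw [h0, sub_zero, W2_self, add_zero] at hlip
  refine hlip.trans (mul_le_mul_of_nonneg_left ?_ hCf)
  simp only [γ, sub_add_cancel_left, norm_neg, norm_smul, Real.norm_eq_abs, abs_of_nonneg hc.1]
  rw [norm_sub_rev z z']
  exact mul_le_of_le_one_left (norm_nonneg _) hc.2.le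

/-- Vanishing outside `K` makes the dynamics Lipschitz in the state on the whole space. -/
lemma norm_dynamics_sub_le (hCf : 0 ≤ Cf) (hK : IsClosed K) (hf : DynHyp T R Cf K f)
    {t : ℝ} (ht : t ∈ Icc 0 T) (hμ : MemP2K K μ) (z z' : Euc d) (u : U) :
    ‖f t z μ u - f t z' μ u‖ ≤ Cf * ‖z - z'‖ := by
  have := hμ.1.1
  by_cases hz : z ∈ K <;> by_cases hz' : z' ∈ K
  · simpa [W2_self] using hf.lipschitz t z z' μ μ u ht hz hz' hμ hμ
  · rw [hf.zero_outside t z' μ u hμ.2 hz', sub_zero]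
    exact norm_dynamics_le_of_notMem hCf hK hf ht hμ hz hz' u
  · rw [hf.zero_outside t z μ u hμ.2 hz, zero_sub, norm_neg, norm_sub_rev]
    exact norm_dynamics_le_of_notMem hCf hK hf ht hμ hz' hz u
  · rw [hf.zero_outside t z μ u hμ.2 hz, hf.zero_outside t z' μ u hμ.2 hz', sub_zero, norm_zero]
    positivity

lemma memP2K_dirac {y : Euc d} (hK : IsClosed K) (hy : y ∈ K) : MemP2K K (Measure.dirac y) := by
  refine ⟨⟨inferInstance, ?_⟩, ?_⟩
  · rw [lintegral_dirac' _ (by fun_prop)]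
    finiteness
  · rw [SuppIn, Measure.dirac_apply' _ hK.measurableSet.compl]
    simpa using hy

lemma aestronglyMeasurable_dynamics [CompactSpace U] [MeasurableSpace U] [BorelSpace U]
    (hCf : 0 < Cf) (hK : IsClosed K) (hf : DynHyp T R Cf K f) {s r : ℝ} (hs : 0 ≤ s) (hrT : r ≤ T)
    {m : ℝ → Measure (Euc d)} (hmP : ∀ t ∈ Icc s r, MemP2K K (m t))
    (hmMeas : ∀ φ : Euc d → ℝ, Continuous φ → (∃ C, ∀ z, |φ z| ≤ C) →
      Measurable fun t => ∫ z, φ z ∂(m t))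
    {y : Euc d} (hy : y ∈ K) {ξ : Measure (ℝ × U)} (hξ : ξ ∈ RelaxedControls (U := U) s r)
    {x : ℝ → Euc d} (hx : Continuous x) :
    AEStronglyMeasurable (fun p : ℝ × U => f p.1 (x p.1) (m p.1) p.2) ξ := by
  classical
  let m' : ℝ → Measure (Euc d) := fun t => if t ∈ Icc s r then m t else Measure.dirac y
  have hm'P : ∀ t, MemP2K K (m' t) := fun t => by
    by_cases ht : t ∈ Icc s r
    · simpa only [m', if_pos ht] using hmP t ht
    · simpa only [m', if_neg ht] using memP2K_dirac hK hy
  have := fun t => (hm'P t).1.1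
  have hm' : Measurable m' := by
    refine measurable_of_forall_continuous_integral fun φ hφ hb => ?_
    have heq : (fun t => ∫ z, φ z ∂(m' t)) =
        fun t => if t ∈ Icc s r then ∫ z, φ z ∂(m t) else ∫ z, φ z ∂(Measure.dirac y) := by
      ext t
      by_cases ht : t ∈ Icc s r
      · simp only [m', if_pos ht]
      · simp only [m', if_neg ht]
    rw [heq]
    exact Measurable.ite measurableSet_Icc (hmMeas φ hφ hb) measurable_const
  refine (measurable_indicator_dynamics hCf hK hf hm' hm'P ⟨y, hy⟩ hx).aestronglyMeasurable.congr ?_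
  filter_upwards [ae_fst_mem_Icc hξ] with p hp
  have hmp : m' p.1 = m p.1 := if_pos hp
  by_cases hxK : x p.1 ∈ K
  · rw [indicator_of_mem (show p ∈ {p : ℝ × U | p.1 ∈ Icc 0 T ∧ x p.1 ∈ K} from
      ⟨⟨hs.trans hp.1, hp.2.trans hrT⟩, hxK⟩), hmp]
  · rw [indicator_of_notMem (fun h => hxK h.2), hf.zero_outside _ _ _ _ (hmP _ hp).2 hxK]

lemma IsTraj.mem [MeasurableSpace U] (hK : IsClosed K)
    (hf : DynHyp T R Cf K f) {s r : ℝ} {m : ℝ → Measure (Euc d)}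
    (hmP : ∀ t ∈ Icc s r, MemP2K K (m t)) {y : Euc d} (hy : y ∈ K) {ξ : Measure (ℝ × U)}
    {x : ℝ → Euc d} (hx : IsTraj f s r m ξ y x)
    (hint : Integrable (fun p : ℝ × U => f p.1 (x p.1) (m p.1) p.2) ξ) :
    ∀ t ∈ Icc s r, x t ∈ K := by
  intro t ht
  by_contra hxt
  obtain ⟨c, hc, hcK, hout⟩ := exists_last_mem hK hx.1 ht.1 (by rwa [hx.2.1]) hxt
  have hzero : ∫ p in Ioc c t ×ˢ (univ : Set U), f p.1 (x p.1) (m p.1) p.2 ∂ξ = 0 :=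
    setIntegral_eq_zero_of_forall_eq_zero fun p hp => hf.zero_outside _ _ _ _
      (hmP _ ⟨hc.1.trans hp.1.1.le, hp.1.2.trans ht.2⟩).2 (hout _ hp.1)
  have hxc : x t = x c := by
    rw [hx.2.2 t ht, hx.2.2 c ⟨hc.1, hc.2.le.trans ht.2⟩]
    rw [← setIntegral_Icc_sub hint hc.1 hc.2.le, sub_eq_zero] at hzero
    rw [hzero]
  exact hxt (hxc ▸ hcK)

end Trajectories

/-- well-posedness of the characteristic ODE: for a Borel measurable flow
`m(·) : [s,r] → P²(K)`, every initial state `y ∈ K` and relaxed control `ξ ∈ U_{s,r}`, the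
initial value problem `ẋ(t) = ∫_U f(t,x(t),m(t),u) ξ(du|t)`, `x(s) = y` (in integral form)
has a solution, every solution stays in `K` on `[s,r]`, and the solution is unique there. -/
theorem characteristic_ode_wellposed
    {d : ℕ} {U : Type} [MetricSpace U] [CompactSpace U] [MeasurableSpace U] [BorelSpace U]
    (T R Cf : ℝ) (hT : 0 < T) (hR : 0 < R) (hCf : 0 < Cf)
    (K : Set (Euc d)) (hK : IsClosed K)
    (f : ℝ → Euc d → Measure (Euc d) → U → Euc d) (hf : DynHyp T R Cf K f)
    (s r : ℝ) (hs : 0 ≤ s) (hsr : s < r) (hrT : r ≤ T)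
    (m : ℝ → Measure (Euc d)) (hmP : ∀ t ∈ Icc s r, MemP2K K (m t))
    -- Borel measurability of the flow `m(·)` (in the weak sense):
    (hmMeas : ∀ φ : Euc d → ℝ, Continuous φ → (∃ C, ∀ z, |φ z| ≤ C) →
      Measurable fun t => ∫ z, φ z ∂(m t))
    (y : Euc d) (hy : y ∈ K)
    (ξ : Measure (ℝ × U)) (hξ : ξ ∈ RelaxedControls (U := U) s r) :
    (∃ x : ℝ → Euc d, IsTraj f s r m ξ y x) ∧
    (∀ x : ℝ → Euc d, IsTraj f s r m ξ y x → ∀ t ∈ Icc s r, x t ∈ K) ∧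
    (∀ x x' : ℝ → Euc d, IsTraj f s r m ξ y x → IsTraj f s r m ξ y x' →
      ∀ t ∈ Icc s r, x t = x' t) := by
  have hξ' : ξ.map Prod.fst = volume.restrict (Icc s r) := hξ
  have hT' : ∀ t ∈ Icc s r, t ∈ Icc 0 T := fun t ht => ⟨hs.trans ht.1, ht.2.trans hrT⟩
  have hm : ∀ x : ℝ → Euc d, Continuous x →
      AEStronglyMeasurable (fun p : ℝ × U => f p.1 (x p.1) (m p.1) p.2) ξ := fun x hx =>
    aestronglyMeasurable_dynamics hCf hK hf hs hrT hmP hmMeas hy hξ hx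
  have hb : ∀ t ∈ Icc s r, ∀ z u, ‖f t z (m t) u‖ ≤ R := fun t ht z u =>
    norm_dynamics_le hR.le hf (hT' t ht) (hmP t ht) z u
  obtain ⟨z, hz, hzuniq⟩ := existsUnique_relaxed_integral_equation hsr.le hξ' hR.le hCf hm hb
    (fun t ht z z' u => norm_dynamics_sub_le hCf.le hK hf (hT' t ht) (hmP t ht) z z' u) y
  have huniq : ∀ x : ℝ → Euc d, IsTraj f s r m ξ y x → ∀ t (ht : t ∈ Icc s r), x t = z ⟨t, ht⟩ := by
    intro x hx t ht
    rw [← hzuniq ((⟨x, hx.1⟩ : C(ℝ, Euc d)).restrict (Icc s r)) fun t => ?_]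
    · rfl
    · refine (hx.2.2 t t.2).trans (congrArg _ (setIntegral_congr_fun
        (measurableSet_Icc.prod MeasurableSet.univ) fun p hp => ?_))
      simp only [IccExtend_of_mem hsr.le _ (⟨hp.1.1, hp.1.2.trans t.2.2⟩ : p.1 ∈ Icc s r)]
      rfl
  refine ⟨⟨IccExtend hsr.le z, z.continuous.Icc_extend', ?_, fun t ht => ?_⟩, fun x hx => ?_,
    fun x x' hx hx' t ht => (huniq x hx t ht).trans (huniq x' hx' t ht).symm⟩
  · have hnull : ξ (Icc s s ×ˢ (univ : Set U)) = 0 := by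
      rw [show Icc s s ×ˢ (univ : Set U) = Prod.fst ⁻¹' Icc s s by ext; simp,
        ← Measure.map_apply measurable_fst measurableSet_Icc, hξ']
      refine Measure.absolutelyContinuous_of_le Measure.restrict_le_self ?_
      simp
    rw [IccExtend_of_mem hsr.le _ (left_mem_Icc.2 hsr.le), hz, setIntegral_measure_zero _ hnull,
      add_zero]
  · rw [IccExtend_of_mem hsr.le _ ht, hz]
  · exact hx.mem hK hf hmP hy
      (integrable_of_bound_fst hξ' (hm x hx.1) fun p hp => hb _ hp _ _)
end
end
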